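/- Let G be a finite group and let (F, F', X, η) be a shifting pair. If there exist r, s ∈ ℤ and c ∈ Ĥ^r(G, X) such that the cup-product map induced by η, (−∪c) : Ĥ^s(G, F(−)) ⇒ Ĥ^{r+s}(G, F'(−)), is a natural isomorphism, then for every j ∈ ℤ the cup-product map (−∪c) : Ĥ^j(G, F(−)) ⇒ Ĥ^{r+j}(G, F'(−)) is a natural isomorphism. -/

import Mathlib

/-!
This file sets up Tate cohomology of a finite group `G` (with coefficients in objects of
`Rep ℤ G`), realized concretely in each degree `n ∈ ℤ` as
`Ĥ^n(G, M) = Ĥ⁰(G, Hom_ℤ(J n, M))`, where `J n` is the standard `n`-th syzygy of the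
trivial module `ℤ` (the `n`-th tensor power of the augmentation ideal `I_G` for `n ≥ 0`,
and of its `ℤ`-linear dual for `n < 0`), and `Ĥ⁰` denotes invariants modulo norms.
Cup products are induced by the canonical comparison maps `J (i+j) ⟶ J i ⊗ J j`.
-/

open CategoryTheory MonoidalCategory TensorProduct

set_option linter.unusedSectionVars false
set_option maxHeartbeats 1000000

attribute [instance 0] AddCommGroup.toIntModule

namespace Enc

variable {k : Type} [CommRing k] {G : Type} [Group G] [Fintype G]

/-! ### Degree-zero Tate cohomology: invariants modulo norms -/

section Aux
variable {V V₂ : Type} [AddCommGroup V] [Module k V] [AddCommGroup V₂] [Module k V₂]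

/-- The norm map `v ↦ ∑_{g ∈ G} g • v` of a representation. -/
noncomputable def rnorm (ρ : Representation k G V) : V →ₗ[k] V := ∑ g : G, ρ g

lemma rnorm_mem_invariants (ρ : Representation k G V) (v : V) :
    rnorm ρ v ∈ ρ.invariants := by
  intro g
  show (ρ g) ((∑ h : G, ρ h) v) = _
  simp only [LinearMap.sum_apply, map_sum]
  rw [Fintype.sum_equiv (Equiv.mulLeft g) _ (fun h => ρ h v) (fun h => by
    rw [← Module.End.mul_apply, ← map_mul]; rfl)]
  simp [rnorm]

/-- The norm map, viewed as landing in the invariants. -/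
noncomputable def rnormRes (ρ : Representation k G V) : V →ₗ[k] ρ.invariants :=
  (rnorm ρ).codRestrict ρ.invariants (rnorm_mem_invariants ρ)

/-- The image of the norm map, inside the invariants. -/
noncomputable def rnormIm (ρ : Representation k G V) : Submodule k ρ.invariants :=
  LinearMap.range (rnormRes ρ)

/-- Degree-zero Tate cohomology of a representation: invariants modulo norms. -/
noncomputable def tate0 (ρ : Representation k G V) : Type :=
  ρ.invariants ⧸ rnormIm ρ

noncomputable instance (ρ : Representation k G V) : AddCommGroup (tate0 ρ) :=
  inferInstanceAs (AddCommGroup (ρ.invariants ⧸ rnormIm ρ))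

noncomputable instance (ρ : Representation k G V) : Module k (tate0 ρ) :=
  inferInstanceAs (Module k (ρ.invariants ⧸ rnormIm ρ))

/-- The Tate class of an invariant vector. -/
noncomputable def tate0mk {ρ : Representation k G V} (v : V) (hv : v ∈ ρ.invariants) :
    tate0 ρ := Submodule.Quotient.mk (⟨v, hv⟩ : ρ.invariants)

lemma invariants_comp {ρ : Representation k G V} {σ : Representation k G V₂}
    (f : V →ₗ[k] V₂) (hf : ∀ (g : G) (v : V), f (ρ g v) = σ g (f v)) :
    ∀ x ∈ ρ.invariants, f x ∈ σ.invariants := by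
  intro x hx g
  rw [← hf g x, hx g]

/-- Functoriality of degree-zero Tate cohomology along equivariant maps. -/
noncomputable def tate0map {ρ : Representation k G V} {σ : Representation k G V₂}
    (f : V →ₗ[k] V₂) (hf : ∀ (g : G) (v : V), f (ρ g v) = σ g (f v)) :
    tate0 ρ →ₗ[k] tate0 σ :=
  Submodule.mapQ (rnormIm ρ) (rnormIm σ) (f.restrict (invariants_comp f hf))
    (by
      rintro ⟨x, hx⟩ ⟨y, hy⟩
      refine ⟨f y, ?_⟩
      apply Subtype.ext
      have hy' := congrArg Subtype.val hy
      show rnorm σ (f y) = _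
      simp only [LinearMap.restrict_apply]
      have : rnorm σ (f y) = f (rnorm ρ y) := by
        simp only [rnorm, LinearMap.sum_apply, map_sum]
        exact Finset.sum_congr rfl fun g _ => (hf g y).symm
      rw [this]
      exact congrArg f hy')

end Aux

/-- Degree-zero Tate cohomology `Ĥ⁰(G, W) = W^G / N_G W` of an object of `Rep k G`. -/
noncomputable def H0T (W : Rep.{0} k G) : Type := tate0 W.ρ

noncomputable instance (W : Rep.{0} k G) : AddCommGroup (H0T W) :=
  inferInstanceAs (AddCommGroup (tate0 W.ρ))

noncomputable instance (W : Rep.{0} k G) : Module k (H0T W) :=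
  inferInstanceAs (Module k (tate0 W.ρ))

/-- Functoriality of `Ĥ⁰` along morphisms of representations. -/
noncomputable def H0Tmap {W W' : Rep.{0} k G} (ψ : W ⟶ W') : H0T W →ₗ[k] H0T W' :=
  tate0map ψ.hom (fun g v => Rep.hom_comm_apply ψ g v)

/-! ### The augmentation ideal and the syzygy modules `J n` -/

variable (G)

/-- The representation of `G` on `H →₀ k` induced by an action of `G` on `H`
(`Representation.ofMulAction` of the older Mathlib). -/
noncomputable def ofMulAction (k : Type*) [CommSemiring k] (G : Type*) [Monoid G] (H : Type*)
    [MulAction G H] : Representation k G (H →₀ k) where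
  toFun g := Finsupp.lmapDomain k k (g • ·)
  map_one' := by
    ext x y
    simp
  map_mul' x y := by
    ext z w
    simp [mul_smul]

/-- The augmentation map `ℤ[G] → ℤ`. -/
noncomputable def aug : (G →₀ ℤ) →ₗ[ℤ] ℤ :=
  Finsupp.linearCombination ℤ (fun _ : G => (1 : ℤ))

lemma aug_comm (g : G) (x : G →₀ ℤ) :
    aug G (ofMulAction ℤ G G g x) = aug G x := by
  unfold aug
  simp [ofMulAction, Finsupp.linearCombination_apply]
  rw [Finsupp.sum_mapDomain_index] <;> simp

/-- The underlying `ℤ`-module of the augmentation ideal. -/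
noncomputable abbrev IGcar : Type := LinearMap.ker (aug G)

/-- The representation of `G` on the augmentation ideal. -/
noncomputable def IGρ : Representation ℤ G (IGcar G) where
  toFun g := (ofMulAction ℤ G G g).restrict (p := LinearMap.ker (aug G))
    (q := LinearMap.ker (aug G)) (by
      intro x hx
      simp only [LinearMap.mem_ker] at hx ⊢
      rw [aug_comm]; exact hx)
  map_one' := by ext x; simp [LinearMap.restrict_apply]
  map_mul' g h := by ext x; simp [LinearMap.restrict_apply, Module.End.mul_apply]

/-- The augmentation ideal `I_G` of `ℤ[G]`, as an object of `Rep ℤ G`. -/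
noncomputable def IGrep : Rep.{0} ℤ G := Rep.of (IGρ G)

/-- `Hom_ℤ(X, A)` with the conjugation `G`-action, i.e. the internal hom in `Rep ℤ G`. -/
noncomputable abbrev hRep {G : Type} [Group G] (X A : Rep.{0} ℤ G) : Rep.{0} ℤ G :=
  (Rep.ihom X).obj A

/-- The `ℤ`-linear dual of the augmentation ideal, as an object of `Rep ℤ G`. -/
noncomputable def DIG : Rep.{0} ℤ G := hRep (IGrep G) (𝟙_ (Rep ℤ G))

instance : Module.Finite ℤ (IGcar G) := by
  have : Module.Finite ℤ (G →₀ ℤ) :=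
    Module.Finite.equiv (Finsupp.linearEquivFunOnFinite ℤ ℤ G).symm
  exact Module.Finite.of_injective (LinearMap.ker (aug G)).subtype Subtype.val_injective

instance : Module.Free ℤ (IGcar G) := by infer_instance

/-- Nonnegative tensor powers `I_G^{⊗ n}` (with `I_G^{⊗ 0} = ℤ`). -/
noncomputable def Jp : ℕ → Rep.{0} ℤ G
  | 0 => 𝟙_ (Rep ℤ G)
  | n + 1 => Jp n ⊗ IGrep G

/-- Tensor powers of the dual of the augmentation ideal. -/
noncomputable def Jn : ℕ → Rep.{0} ℤ G
  | 0 => 𝟙_ (Rep ℤ G)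
  | n + 1 => Jn n ⊗ DIG G

/-- The standard syzygy modules of the trivial representation `ℤ`, indexed by `ℤ`:
`J n = I_G^{⊗ n}` for `n ≥ 0`, and `J n = (I_G^∨)^{⊗ (-n)}` for `n < 0`. -/
noncomputable def J : ℤ → Rep.{0} ℤ G
  | .ofNat n => Jp G n
  | .negSucc n => Jn G (n + 1)

lemma J_ofNat (m : ℕ) : J G (m : ℤ) = Jp G m := rfl

lemma J_neg (m : ℕ) : J G (-(m : ℤ)) = Jn G m := by cases m <;> rfl

/-- The element of `(I_G)^∨ ⊗ I_G` corresponding to the identity map. -/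
noncomputable def preElt : Module.Dual ℤ (IGcar G) ⊗[ℤ] IGcar G :=
  (dualTensorHomEquiv ℤ (IGcar G) (IGcar G)).symm LinearMap.id

/-- The canonical element of `I_G ⊗ (I_G)^∨` corresponding to the identity map. -/
noncomputable def coevElt : (IGrep G ⊗ DIG G).V :=
  (TensorProduct.comm ℤ _ _) (preElt G)

lemma conj_dualTensor_aux {M : Type} [AddCommGroup M] [Module ℤ M] (a b : M →ₗ[ℤ] M)
    (d : Module.Dual ℤ M →ₗ[ℤ] Module.Dual ℤ M) (hd : ∀ f, d f = f ∘ₗ b)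
    (t : Module.Dual ℤ M ⊗[ℤ] M) :
    dualTensorHom ℤ M M (TensorProduct.map d a t) = a ∘ₗ (dualTensorHom ℤ M M t) ∘ₗ b := by
  induction t with
  | zero => simp
  | tmul f v =>
      ext w
      simp [hd]
  | add x y hx hy =>
      simp only [map_add, hx, hy, LinearMap.add_comp, LinearMap.comp_add]

lemma conj_dualTensor (g : G) (t : Module.Dual ℤ (IGcar G) ⊗[ℤ] IGcar G) :
    dualTensorHom ℤ _ _ (TensorProduct.map ((DIG G).ρ g) ((IGrep G).ρ g) t)
      = (IGrep G).ρ g ∘ₗ (dualTensorHom ℤ _ _ t) ∘ₗ (IGrep G).ρ g⁻¹ :=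
  conj_dualTensor_aux ((IGrep G).ρ g) ((IGrep G).ρ g⁻¹) ((DIG G).ρ g) (fun _ => rfl) t

lemma coevElt_invariant (g : G) :
    ((IGrep G ⊗ DIG G).ρ g) (coevElt G) = coevElt G := by
  show TensorProduct.map ((IGrep G).ρ g) ((DIG G).ρ g)
      ((TensorProduct.comm ℤ _ _) (preElt G)) = _
  refine (TensorProduct.map_comm _ _ _).trans ?_
  show (TensorProduct.comm ℤ _ _) (TensorProduct.map ((DIG G).ρ g) ((IGrep G).ρ g) (preElt G))
      = (TensorProduct.comm ℤ _ _) (preElt G)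
  congr 1
  apply (dualTensorHomEquiv ℤ (IGcar G) (IGcar G)).injective
  have h2 : dualTensorHom ℤ (IGcar G) (IGcar G) (preElt G) = LinearMap.id :=
    (dualTensorHomEquiv ℤ (IGcar G) (IGcar G)).apply_symm_apply LinearMap.id
  show dualTensorHom ℤ (IGcar G) (IGcar G)
      (TensorProduct.map ((DIG G).ρ g) ((IGrep G).ρ g) (preElt G))
    = dualTensorHom ℤ (IGcar G) (IGcar G) (preElt G)
  refine (conj_dualTensor G g (preElt G)).trans ?_
  show (IGrep G).ρ g ∘ₗ dualTensorHom ℤ (IGcar G) (IGcar G) (preElt G) ∘ₗ (IGrep G).ρ g⁻¹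
      = dualTensorHom ℤ (IGcar G) (IGcar G) (preElt G)
  rw [h2]
  apply LinearMap.ext
  intro v
  exact (IGrep G).ρ.self_inv_apply g v

/-- The coevaluation `ℤ ⟶ I_G ⊗ I_G^∨`. -/
noncomputable def coev : 𝟙_ (Rep ℤ G) ⟶ IGrep G ⊗ DIG G :=
  Rep.ofHom (ρ := (𝟙_ (Rep ℤ G)).ρ) (σ := (IGrep G ⊗ DIG G).ρ) {
  toLinearMap := LinearMap.toSpanSingleton ℤ _ (coevElt G)
  isIntertwining' := by
    intro g
    apply LinearMap.ext
    intro z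
    show LinearMap.toSpanSingleton ℤ _ (coevElt G) ((𝟙_ (Rep ℤ G)).ρ g z)
        = ((IGrep G ⊗ DIG G).ρ g) (LinearMap.toSpanSingleton ℤ _ (coevElt G) z)
    have hz : ((𝟙_ (Rep ℤ G)).ρ g z) = z := rfl
    rw [hz]
    show z • coevElt G = ((IGrep G ⊗ DIG G).ρ g) (z • coevElt G)
    rw [map_smul, coevElt_invariant] }


variable {G}

/-- One-step comparison `J (n+1) ⟶ J n ⊗ I_G`. -/
noncomputable def sMap : ∀ n : ℤ, J G (n + 1) ⟶ J G n ⊗ IGrep G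
  | .ofNat m => 𝟙 (Jp G m ⊗ IGrep G)
  | .negSucc 0 =>
      coev G ≫ (β_ (IGrep G) (DIG G)).hom ≫ ((λ_ (DIG G)).inv ▷ IGrep G)
  | .negSucc (m+1) =>
      (ρ_ (Jn G (m+1))).inv ≫ (Jn G (m+1) ◁ (coev G ≫ (β_ (IGrep G) (DIG G)).hom))
        ≫ (α_ (Jn G (m+1)) (DIG G) (IGrep G)).inv

/-- One-step comparison `J (n-1) ⟶ J n ⊗ I_G^∨`. -/
noncomputable def tMap : ∀ n : ℤ, J G (n - 1) ⟶ J G n ⊗ DIG G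
  | .ofNat 0 => 𝟙 (𝟙_ (Rep ℤ G) ⊗ DIG G)
  | .ofNat (m+1) =>
      eqToHom (congrArg (J G) (show (Int.ofNat (m+1)) - 1 = ((m:ℕ) : ℤ) by
        rw [Int.ofNat_eq_coe]; push_cast; ring)) ≫
      (ρ_ (Jp G m)).inv ≫ (Jp G m ◁ coev G) ≫ (α_ (Jp G m) (IGrep G) (DIG G)).inv
  | .negSucc m => eqToHom (show J G (Int.negSucc m - 1) = J G (Int.negSucc m) ⊗ DIG G from rfl)

/-- Comparison maps `J (i + m) ⟶ J i ⊗ J m` for `m ≥ 0`. -/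
noncomputable def μpos (i : ℤ) : ∀ m : ℕ, J G (i + m) ⟶ J G i ⊗ J G (m : ℤ)
  | 0 => eqToHom (congrArg (J G) (by omega)) ≫ (ρ_ (J G i)).inv
  | m + 1 =>
      eqToHom (congrArg (J G) (show i + ((m:ℕ)+1:ℕ) = (i + m) + 1 by omega))
        ≫ sMap (i + m) ≫ (μpos i m ▷ IGrep G) ≫ (α_ (J G i) (J G (m:ℤ)) (IGrep G)).hom

/-- Comparison maps `J (i - m) ⟶ J i ⊗ J (-m)` for `m ≥ 0`. -/
noncomputable def μneg (i : ℤ) : ∀ m : ℕ, J G (i - m) ⟶ J G i ⊗ J G (-(m : ℤ))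
  | 0 => eqToHom (congrArg (J G) (by omega)) ≫ (ρ_ (J G i)).inv
  | m + 1 =>
      eqToHom (congrArg (J G) (show i - ((m:ℕ)+1:ℕ) = (i - m) - 1 by omega))
        ≫ tMap (i - m) ≫ (μneg i m ▷ DIG G) ≫ (α_ (J G i) (J G (-(m:ℤ))) (DIG G)).hom
        ≫ (J G i ◁ (eqToHom (show J G (-(m:ℤ)) ⊗ DIG G = J G (-((m:ℕ)+1:ℕ)) by
            rw [J_neg, J_neg]; rfl)))

variable (G)

/-- The canonical comparison map `J (i+j) ⟶ J i ⊗ J j`, implementing the standard stable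
equivalences between the syzygies `J`; it induces the cup product on Tate cohomology. -/
noncomputable def μ (i : ℤ) : ∀ j : ℤ, J G (i + j) ⟶ J G i ⊗ J G j
  | .ofNat m => μpos i m
  | .negSucc m =>
      eqToHom (congrArg (J G) (show i + Int.negSucc m = i - ((m+1 : ℕ) : ℤ) by
        rw [Int.negSucc_eq]; push_cast; ring))
        ≫ μneg i (m+1)

variable {G}

/-! ### Tate cohomology in all degrees, functoriality, cup products -/

/-- Tate cohomology `Ĥ^n(G, M)` of the finite group `G` with coefficients in `M : Rep ℤ G`,
realized as `Ĥ⁰(G, Hom_ℤ(J n, M))` for the standard `n`-th syzygy `J n` of `ℤ`. -/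
noncomputable def tate (n : ℤ) (M : Rep.{0} ℤ G) : Type := H0T (hRep (J G n) M)

noncomputable instance (n : ℤ) (M : Rep.{0} ℤ G) : AddCommGroup (tate n M) :=
  inferInstanceAs (AddCommGroup (H0T (hRep (J G n) M)))

/-- The map on Tate cohomology induced by a morphism of representations. -/
noncomputable def tmap (n : ℤ) {M N : Rep.{0} ℤ G} (φ : M ⟶ N) : tate n M → tate n N :=
  H0Tmap ((Rep.ihom (J G n)).map φ)

/-- Transport of Tate cohomology along an equality of degrees. -/
noncomputable def tcast {i j : ℤ} {M : Rep.{0} ℤ G} (h : i = j) (z : tate i M) : tate j M :=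
  h ▸ z

lemma hom_invariant {X W : Rep.{0} ℤ G} (m : X ⟶ W) :
    m.hom.toLinearMap ∈ (hRep X W).ρ.invariants := by
  intro g
  show W.ρ g ∘ₗ m.hom.toLinearMap ∘ₗ X.ρ g⁻¹ = m.hom.toLinearMap
  ext v
  simp only [LinearMap.comp_apply]
  exact (congrArg (W.ρ g) (Rep.hom_comm_apply m g⁻¹ v)).trans
    (W.ρ.self_inv_apply g (m.hom v))

/-- The Tate cohomology class of a `G`-equivariant map `J n ⟶ W`. -/
noncomputable def mkCls {n : ℤ} {W : Rep.{0} ℤ G} (m : J G n ⟶ W) : tate n W :=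
  tate0mk m.hom.toLinearMap (hom_invariant m)


lemma tensor_rho_eq (M N : Rep.{0} ℤ G) (g : G) :
    (M ⊗ N).ρ g = TensorProduct.map (M.ρ g) (N.ρ g) := rfl

section MapAux
variable {P Q M N T : Type} [AddCommGroup P] [AddCommGroup Q] [AddCommGroup M] [AddCommGroup N]
  [AddCommGroup T] [Module ℤ P] [Module ℤ Q] [Module ℤ M] [Module ℤ N] [Module ℤ T]

lemma map_conj_aux (m : T →ₗ[ℤ] P ⊗[ℤ] Q) (u : P →ₗ[ℤ] M) (w : Q →ₗ[ℤ] N)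
    (a : M →ₗ[ℤ] M) (b : N →ₗ[ℤ] N) (p : P →ₗ[ℤ] P) (q : Q →ₗ[ℤ] Q) (t : T →ₗ[ℤ] T)
    (hm : m ∘ₗ t = TensorProduct.map p q ∘ₗ m) :
    TensorProduct.map a b ∘ₗ ((TensorProduct.map u w).comp m) ∘ₗ t
      = (TensorProduct.map (a ∘ₗ u ∘ₗ p) (b ∘ₗ w ∘ₗ q)).comp m := by
  rw [LinearMap.comp_assoc, hm, TensorProduct.map_comp, TensorProduct.map_comp,
    LinearMap.comp_assoc, LinearMap.comp_assoc]

lemma map_sum_left_aux {ι : Type} (s : Finset ι) (m : T →ₗ[ℤ] P ⊗[ℤ] Q)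
    (f : ι → P →ₗ[ℤ] M) (w : Q →ₗ[ℤ] N) :
    (TensorProduct.map (∑ i ∈ s, f i) w).comp m = ∑ i ∈ s, (TensorProduct.map (f i) w).comp m := by
  classical
  induction s using Finset.induction_on with
  | empty => simp
  | insert a s ha ih =>
      rw [Finset.sum_insert ha, Finset.sum_insert ha, TensorProduct.map_add_left,
        LinearMap.add_comp, ih]

lemma map_sum_right_aux {ι : Type} (s : Finset ι) (m : T →ₗ[ℤ] P ⊗[ℤ] Q)
    (u : P →ₗ[ℤ] M) (f : ι → Q →ₗ[ℤ] N) :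
    (TensorProduct.map u (∑ i ∈ s, f i)).comp m = ∑ i ∈ s, (TensorProduct.map u (f i)).comp m := by
  classical
  induction s using Finset.induction_on with
  | empty => simp
  | insert a s ha ih =>
      rw [Finset.sum_insert ha, Finset.sum_insert ha, TensorProduct.map_add_right,
        LinearMap.add_comp, ih]

lemma map_sub_left_aux (m : T →ₗ[ℤ] P ⊗[ℤ] Q) (u u' : P →ₗ[ℤ] M) (w : Q →ₗ[ℤ] N) :
    (TensorProduct.map (u - u') w).comp m
      = (TensorProduct.map u w).comp m - (TensorProduct.map u' w).comp m := by
  rw [eq_sub_iff_add_eq, ← LinearMap.add_comp, ← TensorProduct.map_add_left, sub_add_cancel]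

lemma map_sub_right_aux (m : T →ₗ[ℤ] P ⊗[ℤ] Q) (u : P →ₗ[ℤ] M) (w w' : Q →ₗ[ℤ] N) :
    (TensorProduct.map u (w - w')).comp m
      = (TensorProduct.map u w).comp m - (TensorProduct.map u w').comp m := by
  rw [eq_sub_iff_add_eq, ← LinearMap.add_comp, ← TensorProduct.map_add_right, sub_add_cancel]

end MapAux

lemma cup_invariance {i j : ℤ} {M N : Rep.{0} ℤ G}
    (f : ((hRep (J G i) M).ρ.invariants))
    (g : ((hRep (J G j) N).ρ.invariants)) :
    (TensorProduct.map f.1 g.1).comp ((μ G i j).hom.toLinearMap)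
      ∈ (hRep (J G (i + j)) (M ⊗ N)).ρ.invariants := by
  intro gg
  have hf : M.ρ gg ∘ₗ f.1 ∘ₗ (J G i).ρ gg⁻¹ = f.1 := f.2 gg
  have hg : N.ρ gg ∘ₗ g.1 ∘ₗ (J G j).ρ gg⁻¹ = g.1 := g.2 gg
  have hμ : (μ G i j).hom.toLinearMap.comp ((J G (i + j)).ρ gg⁻¹)
      = (TensorProduct.map ((J G i).ρ gg⁻¹) ((J G j).ρ gg⁻¹)).comp (μ G i j).hom.toLinearMap := by
    exact (μ G i j).hom.isIntertwining' gg⁻¹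
  show (M ⊗ N).ρ gg ∘ₗ ((TensorProduct.map f.1 g.1).comp (μ G i j).hom.toLinearMap)
        ∘ₗ (J G (i + j)).ρ gg⁻¹
      = (TensorProduct.map f.1 g.1).comp (μ G i j).hom.toLinearMap
  exact (map_conj_aux (μ G i j).hom.toLinearMap f.1 g.1 (M.ρ gg) (N.ρ gg) _ _ _ hμ).trans
    (congrArg₂ (fun x y => (TensorProduct.map x y).comp (μ G i j).hom.toLinearMap) hf hg)

lemma conj_term {i j : ℤ} {M N : Rep.{0} ℤ G} (u : (J G i).V →ₗ[ℤ] M.V)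
    (w : (J G j).V →ₗ[ℤ] N.V) (h : G) :
    (TensorProduct.map (M.ρ h ∘ₗ u ∘ₗ (J G i).ρ h⁻¹) (N.ρ h ∘ₗ w ∘ₗ (J G j).ρ h⁻¹)).comp
        (μ G i j).hom.toLinearMap
      = ((hRep (J G (i + j)) (M ⊗ N)).ρ h) ((TensorProduct.map u w).comp (μ G i j).hom.toLinearMap) := by
  have hμ : (μ G i j).hom.toLinearMap ∘ₗ (J G (i + j)).ρ h⁻¹
      = TensorProduct.map ((J G i).ρ h⁻¹) ((J G j).ρ h⁻¹) ∘ₗ (μ G i j).hom.toLinearMap := by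
    exact (μ G i j).hom.isIntertwining' h⁻¹
  show _ = (M ⊗ N).ρ h ∘ₗ ((TensorProduct.map u w).comp (μ G i j).hom.toLinearMap) ∘ₗ (J G (i + j)).ρ h⁻¹
  exact (map_conj_aux (μ G i j).hom.toLinearMap u w (M.ρ h) (N.ρ h) _ _ _ hμ).symm

lemma cup_norm_left {i j : ℤ} {M N : Rep.{0} ℤ G} (u : (J G i).V →ₗ[ℤ] M.V)
    (g : ((hRep (J G j) N).ρ.invariants)) :
    (TensorProduct.map (rnorm ((hRep (J G i) M).ρ) u) g.1).comp (μ G i j).hom.toLinearMap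
      = rnorm ((hRep (J G (i + j)) (M ⊗ N)).ρ)
          ((TensorProduct.map u g.1).comp (μ G i j).hom.toLinearMap) := by
  have h1 : rnorm ((hRep (J G i) M).ρ) u = ∑ h : G, ((hRep (J G i) M).ρ h) u := by
    exact LinearMap.sum_apply _ _ _
  have h2 : rnorm ((hRep (J G (i + j)) (M ⊗ N)).ρ) ((TensorProduct.map u g.1).comp (μ G i j).hom.toLinearMap)
      = ∑ h : G, ((hRep (J G (i + j)) (M ⊗ N)).ρ h)
          ((TensorProduct.map u g.1).comp (μ G i j).hom.toLinearMap) := by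
    exact LinearMap.sum_apply _ _ _
  refine (congrArg (fun x => (TensorProduct.map x g.1).comp (μ G i j).hom.toLinearMap) h1).trans
    ((map_sum_left_aux _ (μ G i j).hom.toLinearMap _ g.1).trans
      (Eq.trans (Finset.sum_congr rfl fun h _ => ?_) h2.symm))
  have hginv : N.ρ h ∘ₗ g.1 ∘ₗ (J G j).ρ h⁻¹ = g.1 := g.2 h
  exact (congrArg (fun x => (TensorProduct.map (M.ρ h ∘ₗ u ∘ₗ (J G i).ρ h⁻¹) x).comp
    (μ G i j).hom.toLinearMap) hginv.symm).trans (conj_term u g.1 h)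

lemma cup_norm_right {i j : ℤ} {M N : Rep.{0} ℤ G}
    (f : ((hRep (J G i) M).ρ.invariants)) (w : (J G j).V →ₗ[ℤ] N.V) :
    (TensorProduct.map f.1 (rnorm ((hRep (J G j) N).ρ) w)).comp (μ G i j).hom.toLinearMap
      = rnorm ((hRep (J G (i + j)) (M ⊗ N)).ρ)
          ((TensorProduct.map f.1 w).comp (μ G i j).hom.toLinearMap) := by
  have h1 : rnorm ((hRep (J G j) N).ρ) w = ∑ h : G, ((hRep (J G j) N).ρ h) w := by
    exact LinearMap.sum_apply _ _ _
  have h2 : rnorm ((hRep (J G (i + j)) (M ⊗ N)).ρ) ((TensorProduct.map f.1 w).comp (μ G i j).hom.toLinearMap)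
      = ∑ h : G, ((hRep (J G (i + j)) (M ⊗ N)).ρ h)
          ((TensorProduct.map f.1 w).comp (μ G i j).hom.toLinearMap) := by
    exact LinearMap.sum_apply _ _ _
  refine (congrArg (fun x => (TensorProduct.map f.1 x).comp (μ G i j).hom.toLinearMap) h1).trans
    ((map_sum_right_aux _ (μ G i j).hom.toLinearMap f.1 _).trans
      (Eq.trans (Finset.sum_congr rfl fun h _ => ?_) h2.symm))
  have hfinv : M.ρ h ∘ₗ f.1 ∘ₗ (J G i).ρ h⁻¹ = f.1 := f.2 h
  exact (congrArg (fun x => (TensorProduct.map x (N.ρ h ∘ₗ w ∘ₗ (J G j).ρ h⁻¹)).comp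
    (μ G i j).hom.toLinearMap) hfinv.symm).trans (conj_term f.1 w h)

lemma cup_welldef {i j : ℤ} {M N : Rep.{0} ℤ G}
    (a₁ : ((hRep (J G i) M).ρ.invariants)) (b₁ : ((hRep (J G j) N).ρ.invariants))
    (a₂ : ((hRep (J G i) M).ρ.invariants)) (b₂ : ((hRep (J G j) N).ρ.invariants))
    (ha : a₁ - a₂ ∈ rnormIm ((hRep (J G i) M).ρ))
    (hb : b₁ - b₂ ∈ rnormIm ((hRep (J G j) N).ρ)) :
    tate0mk (ρ := (hRep (J G (i + j)) (M ⊗ N)).ρ) ((TensorProduct.map a₁.1 b₁.1).comp ((μ G i j).hom.toLinearMap)) (cup_invariance a₁ b₁)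
      = tate0mk (ρ := (hRep (J G (i + j)) (M ⊗ N)).ρ) ((TensorProduct.map a₂.1 b₂.1).comp ((μ G i j).hom.toLinearMap)) (cup_invariance a₂ b₂) := by
  obtain ⟨u, hu⟩ := ha
  obtain ⟨w, hw⟩ := hb
  have hu' : rnorm ((hRep (J G i) M).ρ) u = a₁.1 - a₂.1 := congrArg Subtype.val hu
  have hw' : rnorm ((hRep (J G j) N).ρ) w = b₁.1 - b₂.1 := congrArg Subtype.val hw
  have step1 : tate0mk (ρ := (hRep (J G (i + j)) (M ⊗ N)).ρ) ((TensorProduct.map a₁.1 b₁.1).comp ((μ G i j).hom.toLinearMap))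
        (cup_invariance a₁ b₁)
      = tate0mk (ρ := (hRep (J G (i + j)) (M ⊗ N)).ρ) ((TensorProduct.map a₂.1 b₁.1).comp ((μ G i j).hom.toLinearMap)) (cup_invariance a₂ b₁) := by
    refine (Submodule.Quotient.eq _).mpr ?_
    refine ⟨(TensorProduct.map u b₁.1).comp ((μ G i j).hom.toLinearMap), ?_⟩
    apply Subtype.ext
    have key := (congrArg (fun x => (TensorProduct.map x b₁.1).comp (μ G i j).hom.toLinearMap) hu').symm.trans
      (cup_norm_left u b₁)
    refine key.symm.trans ?_
    show _ = (TensorProduct.map a₁.1 b₁.1).comp ((μ G i j).hom.toLinearMap)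
        - (TensorProduct.map a₂.1 b₁.1).comp ((μ G i j).hom.toLinearMap)
    exact map_sub_left_aux (μ G i j).hom.toLinearMap a₁.1 a₂.1 b₁.1
  have step2 : tate0mk (ρ := (hRep (J G (i + j)) (M ⊗ N)).ρ) ((TensorProduct.map a₂.1 b₁.1).comp ((μ G i j).hom.toLinearMap))
        (cup_invariance a₂ b₁)
      = tate0mk (ρ := (hRep (J G (i + j)) (M ⊗ N)).ρ) ((TensorProduct.map a₂.1 b₂.1).comp ((μ G i j).hom.toLinearMap)) (cup_invariance a₂ b₂) := by
    refine (Submodule.Quotient.eq _).mpr ?_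
    refine ⟨(TensorProduct.map a₂.1 w).comp ((μ G i j).hom.toLinearMap), ?_⟩
    apply Subtype.ext
    have key := (congrArg (fun x => (TensorProduct.map a₂.1 x).comp (μ G i j).hom.toLinearMap) hw').symm.trans
      (cup_norm_right a₂ w)
    refine key.symm.trans ?_
    show _ = (TensorProduct.map a₂.1 b₁.1).comp ((μ G i j).hom.toLinearMap)
        - (TensorProduct.map a₂.1 b₂.1).comp ((μ G i j).hom.toLinearMap)
    exact map_sub_right_aux (μ G i j).hom.toLinearMap a₂.1 b₁.1 b₂.1
  exact step1.trans step2

/-- The cup product `Ĥ^i(G, M) × Ĥ^j(G, N) → Ĥ^{i+j}(G, M ⊗ N)` on Tate cohomology,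
induced by the comparison maps `μ`. -/
noncomputable def cup {i j : ℤ} {M N : Rep.{0} ℤ G} (z₁ : tate i M) (z₂ : tate j N) :
    tate (i + j) (M ⊗ N) :=
  Quotient.liftOn₂ z₁ z₂
    (fun f g => tate0mk ((TensorProduct.map f.1 g.1).comp ((μ G i j).hom.toLinearMap)) (cup_invariance f g))
    (fun a₁ b₁ a₂ b₂ ha hb => cup_welldef a₁ b₁ a₂ b₂
      ((Submodule.quotientRel_def _).mp ha) ((Submodule.quotientRel_def _).mp hb))

/-! ### Pairings -/

/-- The composition pairing `Hom_ℤ(B, C) ⊗ Hom_ℤ(A, B) ⟶ Hom_ℤ(A, C)`, `f ⊗ φ ↦ f ∘ φ`. -/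
noncomputable def compPair (A B C : Rep.{0} ℤ G) : hRep B C ⊗ hRep A B ⟶ hRep A C :=
  MonoidalClosed.curry <|
    (A ◁ (β_ (hRep B C) (hRep A B)).hom) ≫ (α_ A (hRep A B) (hRep B C)).inv
      ≫ (((ihom.ev A).app B) ▷ hRep B C) ≫ (ihom.ev B).app C

/-- The evaluation pairing `Hom_ℤ(X, B) ⊗ X ⟶ B`, `f ⊗ x ↦ f x`. -/
noncomputable def evPair (X B : Rep.{0} ℤ G) : hRep X B ⊗ X ⟶ B :=
  (β_ (hRep X B) X).hom ≫ (ihom.ev X).app B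

/-- The cup product `Ĥ^i(G, Hom(X, A)) × Ĥ^j(G, Hom(X', X)) → Ĥ^{i+j}(G, Hom(X', A))`
induced by the composition pairing. -/
noncomputable def ccup {i j : ℤ} {X X' A : Rep.{0} ℤ G}
    (z : tate i (hRep X A)) (x : tate j (hRep X' X)) : tate (i + j) (hRep X' A) :=
  tmap (i + j) (compPair X' X A) (cup z x)

/-- `ccup`, with the degree of the target adjusted along an equality of integers. -/
noncomputable def ccupTo {i j m : ℤ} {X X' A : Rep.{0} ℤ G}
    (z : tate i (hRep X A)) (x : tate j (hRep X' X)) (h : i + j = m) :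
    tate m (hRep X' A) :=
  tcast h (ccup z x)

/-- The class of the identity in `Ĥ⁰(G, Hom_ℤ(X, X))`. -/
noncomputable def idCls (X : Rep.{0} ℤ G) : tate 0 (hRep X X) :=
  mkCls (MonoidalClosed.curry (ρ_ X).hom)

/-! ### Encoding pairs and related notions -/

/-- `(X, X')` is an *`r`-encoding pair* if for some `i ∈ ℤ` there is a natural isomorphism
of functors `Ĥ^i(G, Hom_ℤ(X, -)) ≅ Ĥ^{i+r}(G, Hom_ℤ(X', -))` on `Rep ℤ G`. -/
def IsEncodingPair {G : Type} [Group G] [Fintype G] (r : ℤ) (X X' : Rep.{0} ℤ G) : Prop :=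
  ∃ (i : ℤ) (e : ∀ A : Rep.{0} ℤ G, tate i (hRep X A) ≃+ tate (i + r) (hRep X' A)),
    ∀ {A B : Rep.{0} ℤ G} (φ : A ⟶ B) (z : tate i (hRep X A)),
      e B (tmap i ((Rep.ihom X).map φ) z) = tmap (i + r) ((Rep.ihom X').map φ) (e A z)

/-- `x ∈ Ĥ^r(G, Hom_ℤ(X', X))` is an *encoding element* for the pair `(X, X')` if it has a
*decoding element* `x' ∈ Ĥ^{-r}(G, Hom_ℤ(X, X'))` with `x' ∪ x = [id_{X'}]` and
`x ∪ x' = [id_X]`. -/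
def IsEncodingElement {G : Type} [Group G] [Fintype G] {r : ℤ} (X X' : Rep.{0} ℤ G)
    (x : tate r (hRep X' X)) : Prop :=
  ∃ x' : tate (-r) (hRep X X'),
    ccupTo x' x (by ring) = idCls X' ∧ ccupTo x x' (by ring) = idCls X

/-- The induced `G`-module `ℤ[G] ⊗_ℤ A ≅ (G →₀ A)`, with `G` acting by left translation. -/
noncomputable def indRep (G : Type) [Group G] (A : Type) [AddCommGroup A] [Module ℤ A] :
    Rep.{0} ℤ G :=
  Rep.of (G := G) (X := G →₀ A)
    { toFun := fun g => Finsupp.lmapDomain A ℤ (fun h => g * h)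
      map_one' := by
        ext x h
        simp [Finsupp.lmapDomain_apply, Finsupp.mapDomain_id, one_mul]
      map_mul' := fun g g' => by
        ext x h
        simp [Finsupp.lmapDomain_apply, Module.End.mul_apply, Finsupp.mapDomain_single,
          mul_assoc] }

/-- A `G`-module is *induced* if it is isomorphic to `ℤ[G] ⊗_ℤ A` for some abelian group `A`. -/
def IsInduced {G : Type} [Group G] (M : Rep.{0} ℤ G) : Prop :=
  ∃ (A : Type) (_ : AddCommGroup A) (_ : Module ℤ A), Nonempty (M ≅ indRep G A)

/-- A class `φ ∈ Ĥ⁰(G, Hom_ℤ(X, X))` is a unit for the (composition) cup product. -/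
def IsUnitCls {G : Type} [Group G] [Fintype G] {X : Rep.{0} ℤ G}
    (φ : tate 0 (hRep X X)) : Prop :=
  ∃ ψ : tate 0 (hRep X X),
    ccupTo φ ψ (by ring) = idCls X ∧ ccupTo ψ φ (by ring) = idCls X


/-- The natural map `Hom_ℤ(X, A) ⊗ I_G ⟶ Hom_ℤ(X, A ⊗ I_G)`, `f ⊗ z ↦ (x ↦ f x ⊗ z)`. -/
noncomputable def pr0 (X A : Rep.{0} ℤ G) : hRep X A ⊗ IGrep G ⟶ hRep X (A ⊗ IGrep G) :=
  MonoidalClosed.curry ((α_ X (hRep X A) (IGrep G)).inv ≫ ((ihom.ev X).app A ▷ IGrep G))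

/-- The natural evaluation map `Hom_ℤ(X, Hom_ℤ(I_G, A)) ⊗ I_G ⟶ Hom_ℤ(X, A)`,
`f ⊗ z ↦ (x ↦ f x z)`. -/
noncomputable def pr1 (X A : Rep.{0} ℤ G) :
    hRep X (hRep (IGrep G) A) ⊗ IGrep G ⟶ hRep X A :=
  MonoidalClosed.curry ((α_ X (hRep X (hRep (IGrep G) A)) (IGrep G)).inv
    ≫ ((ihom.ev X).app (hRep (IGrep G) A) ▷ IGrep G) ≫ evPair (IGrep G) A)

/-- The natural evaluation map `Hom_ℤ(X', X) ⊗ (X' ⊗ A) ⟶ X ⊗ A`. -/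
noncomputable def tPair (X' X A : Rep.{0} ℤ G) : hRep X' X ⊗ (X' ⊗ A) ⟶ X ⊗ A :=
  (α_ (hRep X' X) X' A).inv ≫ (evPair X' X ▷ A)

/-- A functor `Rep ℤ G ⥤ Rep ℤ G` sends `ℤ`-split short exact sequences of `G`-modules to
short exact sequences of `G`-modules. -/
def PreservesZSplitSES {G : Type} [Group G] (F : Rep.{0} ℤ G ⥤ Rep.{0} ℤ G) : Prop :=
  ∀ (A B C : Rep.{0} ℤ G) (f : A ⟶ B) (g : B ⟶ C),
    Function.Injective f.hom → Function.Surjective g.hom → Function.Exact f.hom g.hom →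
    (∃ s : C.V →+ B.V, ∀ x, g.hom (s x) = x) →
    Function.Injective (F.map f).hom ∧ Function.Surjective (F.map g).hom ∧
      Function.Exact (F.map f).hom (F.map g).hom

/-- A *shiftable functor*: it sends `ℤ`-split short exact sequences of `G`-modules to short
exact sequences, and sends induced modules to induced modules. -/
def Shiftable {G : Type} [Group G] (F : Rep.{0} ℤ G ⥤ Rep.{0} ℤ G) : Prop :=
  PreservesZSplitSES F ∧ ∀ M : Rep.{0} ℤ G, IsInduced M → IsInduced (F.obj M)

end Enc

namespace Enc

section
variable {G : Type} [Group G] [Fintype G]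

/-- A morphism is null if it is a norm of a linear map. -/
def IsNull {W M : Rep.{0} ℤ G} (f : W ⟶ M) : Prop :=
  ∃ u : W.V →ₗ[ℤ] M.V, ∀ w : W.V, f.hom w = ∑ h : G, M.ρ h (u (W.ρ h⁻¹ w))

lemma IsNull.zero {W M : Rep.{0} ℤ G} : IsNull (0 : W ⟶ M) :=
  ⟨0, fun w => by simp [Rep.zero_hom]⟩

lemma IsNull.add {W M : Rep.{0} ℤ G} {f g : W ⟶ M} (hf : IsNull f) (hg : IsNull g) :
    IsNull (f + g) := by
  obtain ⟨u, hu⟩ := hf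
  obtain ⟨v, hv⟩ := hg
  refine ⟨u + v, fun w => ?_⟩
  have : (f + g).hom w = f.hom w + g.hom w := rfl
  rw [this, hu, hv, ← Finset.sum_add_distrib]
  simp

lemma IsNull.neg {W M : Rep.{0} ℤ G} {f : W ⟶ M} (hf : IsNull f) :
    IsNull (-f) := by
  obtain ⟨u, hu⟩ := hf
  refine ⟨-u, fun w => ?_⟩
  have : (-f).hom w = - f.hom w := rfl
  rw [this, hu, ← Finset.sum_neg_distrib]
  simp

lemma IsNull.sub {W M : Rep.{0} ℤ G} {f g : W ⟶ M} (hf : IsNull f) (hg : IsNull g) :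
    IsNull (f - g) := by
  rw [sub_eq_add_neg]; exact hf.add hg.neg

lemma IsNull.comp_right {W M N : Rep.{0} ℤ G} {f : W ⟶ M} (hf : IsNull f) (g : M ⟶ N) :
    IsNull (f ≫ g) := by
  obtain ⟨u, hu⟩ := hf
  refine ⟨g.hom.toLinearMap ∘ₗ u, fun w => ?_⟩
  have : (f ≫ g).hom w = g.hom (f.hom w) := rfl
  rw [this, hu, map_sum]
  exact Finset.sum_congr rfl fun h _ => Rep.hom_comm_apply g h _

lemma IsNull.comp_left {W M N : Rep.{0} ℤ G} {f : W ⟶ M} (hf : IsNull f) (g : N ⟶ W) :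
    IsNull (g ≫ f) := by
  obtain ⟨u, hu⟩ := hf
  refine ⟨u ∘ₗ g.hom.toLinearMap, fun w => ?_⟩
  have : (g ≫ f).hom w = f.hom (g.hom w) := rfl
  rw [this, hu]
  refine Finset.sum_congr rfl fun h _ => ?_
  rw [← Rep.hom_comm_apply g h⁻¹]
  rfl

lemma IsNull.whiskerRight {W M : Rep.{0} ℤ G} {f : W ⟶ M} (hf : IsNull f) (N : Rep.{0} ℤ G) :
    IsNull (f ▷ N) := by
  obtain ⟨u, hu⟩ := hf
  refine ⟨TensorProduct.map u LinearMap.id, fun w => ?_⟩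
  induction w using TensorProduct.induction_on with
  | zero => simp
  | add x y hx hy =>
    simp only [map_add, Finset.sum_add_distrib] at hx hy ⊢
    rw [hx, hy]
  | tmul x y =>
    have h1 : (f ▷ N).hom (x ⊗ₜ y) = (f.hom x) ⊗ₜ[ℤ] y := rfl
    refine h1.trans ?_
    rw [hu, TensorProduct.sum_tmul]
    refine Finset.sum_congr rfl fun h _ => ?_
    show _ = (M.ρ h (u (W.ρ h⁻¹ x))) ⊗ₜ[ℤ] (N.ρ h (N.ρ h⁻¹ y))
    rw [N.ρ.self_inv_apply]

lemma IsNull.of_iso_conj {W M W' M' : Rep.{0} ℤ G} {f : W ⟶ M} {f' : W' ⟶ M'}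
    (a : W' ⟶ W) (b : M ⟶ M') (h : f' = a ≫ f ≫ b) (hf : IsNull f) : IsNull f' := by
  rw [h]; exact (hf.comp_right b).comp_left a

lemma IsNull.whiskerLeft {W M : Rep.{0} ℤ G} {f : W ⟶ M} (hf : IsNull f) (N : Rep.{0} ℤ G) :
    IsNull (N ◁ f) :=
  IsNull.of_iso_conj (β_ N W).hom (β_ M N).hom (by simp) (hf.whiskerRight N)

/-- Stable isomorphisms. -/
def StIso {W M : Rep.{0} ℤ G} (f : W ⟶ M) : Prop :=
  ∃ g : M ⟶ W, IsNull (f ≫ g - 𝟙 W) ∧ IsNull (g ≫ f - 𝟙 M)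

lemma StIso.of_isIso {W M : Rep.{0} ℤ G} (f : W ⟶ M) [IsIso f] : StIso f :=
  ⟨inv f, by simpa using IsNull.zero, by simpa using IsNull.zero⟩

lemma StIso.comp {W M N : Rep.{0} ℤ G} {f : W ⟶ M} {g : M ⟶ N} (hf : StIso f) (hg : StIso g) :
    StIso (f ≫ g) := by
  obtain ⟨f', h1, h2⟩ := hf
  obtain ⟨g', h3, h4⟩ := hg
  refine ⟨g' ≫ f', ?_, ?_⟩
  · have : (f ≫ g) ≫ g' ≫ f' - 𝟙 W = f ≫ (g ≫ g' - 𝟙 M) ≫ f' + (f ≫ f' - 𝟙 W) := by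
      simp [Preadditive.sub_comp, Preadditive.comp_sub]
    rw [this]
    exact ((h3.comp_right f').comp_left f).add h1
  · have : (g' ≫ f') ≫ f ≫ g - 𝟙 N = g' ≫ (f' ≫ f - 𝟙 M) ≫ g + (g' ≫ g - 𝟙 N) := by
      simp [Preadditive.sub_comp, Preadditive.comp_sub]
    rw [this]
    exact ((h2.comp_right g).comp_left g').add h4

lemma StIso.whiskerRight {W M : Rep.{0} ℤ G} {f : W ⟶ M} (hf : StIso f) (N : Rep.{0} ℤ G) :
    StIso (f ▷ N) := by
  obtain ⟨f', h1, h2⟩ := hf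
  have e : ∀ {W M : Rep.{0} ℤ G} (f : W ⟶ M) (f' : M ⟶ W),
      (f ▷ N) ≫ (f' ▷ N) - 𝟙 _ = (f ≫ f' - 𝟙 W) ▷ N := by
    intro W M f f'
    rw [sub_eq_add_neg, sub_eq_add_neg, MonoidalPreadditive.add_whiskerRight]
    congr 1
    simp
  refine ⟨f' ▷ N, ?_, ?_⟩
  · rw [e]; exact h1.whiskerRight N
  · rw [e]; exact h2.whiskerRight N

lemma StIso.whiskerLeft {W M : Rep.{0} ℤ G} {f : W ⟶ M} (hf : StIso f) (N : Rep.{0} ℤ G) :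
    StIso (N ◁ f) := by
  have : N ◁ f = (β_ N W).hom ≫ (f ▷ N) ≫ (β_ M N).hom := by simp
  rw [this]
  exact (StIso.of_isIso _).comp ((hf.whiskerRight N).comp (StIso.of_isIso _))

lemma mkCls_surj {n : ℤ} {M : Rep.{0} ℤ G} (z : tate n M) : ∃ f : J G n ⟶ M, mkCls f = z := by
  obtain ⟨⟨v, hv⟩, rfl⟩ := Submodule.Quotient.mk_surjective _ z
  change (J G n).V →ₗ[ℤ] M.V at v
  refine ⟨Rep.ofHom (ρ := (J G n).ρ) (σ := M.ρ) ⟨v, fun g => ?_⟩, rfl⟩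
  have h := hv g
  have h' : M.ρ g ∘ₗ v ∘ₗ (J G n).ρ g⁻¹ = v := h
  apply LinearMap.ext
  intro x
  have h2 : M.ρ g (v ((J G n).ρ g⁻¹ ((J G n).ρ g x))) = v ((J G n).ρ g x) :=
    LinearMap.congr_fun h' ((J G n).ρ g x)
  rw [Representation.inv_self_apply] at h2
  exact h2.symm

lemma mkCls_eq_iff {n : ℤ} {M : Rep.{0} ℤ G} (f g : J G n ⟶ M) :
    mkCls f = mkCls g ↔ IsNull (f - g) := by
  refine (Submodule.Quotient.eq _).trans ?_
  have key : ∀ (u : (J G n).V →ₗ[ℤ] M.V) (w : (J G n).V),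
      (show (J G n).V →ₗ[ℤ] M.V from rnorm (hRep (J G n) M).ρ u) w
      = ∑ h : G, M.ρ h (u ((J G n).ρ h⁻¹ w)) := by
    intro u w
    have h1 : rnorm (hRep (J G n) M).ρ u = ∑ h : G, (hRep (J G n) M).ρ h u :=
      LinearMap.sum_apply _ _ _
    rw [h1]
    exact LinearMap.sum_apply (Finset.univ : Finset G)
      (fun h => M.ρ h ∘ₗ u ∘ₗ (J G n).ρ h⁻¹) w
  constructor
  · rintro ⟨u, hu⟩
    refine ⟨u, fun w => ?_⟩
    refine Eq.trans ?_ (key u w)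
    exact (LinearMap.congr_fun (congrArg Subtype.val hu) w).symm
  · rintro ⟨u, hu⟩
    refine ⟨u, Subtype.ext (LinearMap.ext fun w => ?_)⟩
    exact (key u w).trans (hu w).symm

lemma cup_mkCls {i j : ℤ} {M N : Rep.{0} ℤ G} (f : J G i ⟶ M) (g : J G j ⟶ N) :
    cup (mkCls f) (mkCls g) = mkCls (μ G i j ≫ (f ⊗ₘ g)) := rfl

lemma tmap_mkCls {i : ℤ} {M N : Rep.{0} ℤ G} (f : J G i ⟶ M) (g : M ⟶ N) :
    tmap i g (mkCls f) = mkCls (f ≫ g) := rfl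

end

section
variable {G : Type} [Group G] [Fintype G]

lemma tensor_identity_aux {R ι M N : Type} [CommRing R] [Fintype ι] [AddCommGroup M] [AddCommGroup N]
    [Module R M] [Module R N] (x p : ι → R) (a : ι → M) (b : ι → N)
    (hx : ∑ i, x i = 0) (hb : ∑ i, b i = 0) :
    ∑ g, ∑ h, (x g * (p h - p g)) • ((a g - a h) ⊗ₜ[R] b h)
      = (∑ g, x g • a g) ⊗ₜ[R] (∑ h, p h • b h) + (∑ g, x g * p g) • ∑ h, a h ⊗ₜ[R] b h := by
  have e1 : (∑ g, x g • a g) ⊗ₜ[R] (∑ h, p h • b h)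
      = ∑ g, ∑ h, (x g * p h) • (a g ⊗ₜ[R] b h) := by
    rw [TensorProduct.sum_tmul]
    refine Finset.sum_congr rfl fun g _ => ?_
    rw [TensorProduct.tmul_sum]
    refine Finset.sum_congr rfl fun h _ => ?_
    rw [TensorProduct.smul_tmul_smul]
  have e2 : (∑ g, x g * p g) • ∑ h, a h ⊗ₜ[R] b h
      = ∑ g, ∑ h, (x g * p g) • (a h ⊗ₜ[R] b h) := by
    rw [Finset.sum_smul]
    exact Finset.sum_congr rfl fun g _ => Finset.smul_sum
  have e3 : (0 : M ⊗[R] N) = ∑ g, ∑ h, (x g * p g) • (a g ⊗ₜ[R] b h) := by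
    symm
    refine Finset.sum_eq_zero fun g _ => ?_
    rw [← Finset.smul_sum, ← TensorProduct.tmul_sum, hb, TensorProduct.tmul_zero, smul_zero]
  have e4 : (0 : M ⊗[R] N) = ∑ g, ∑ h, (x g * p h) • (a h ⊗ₜ[R] b h) := by
    rw [Finset.sum_comm]
    symm
    refine Finset.sum_eq_zero fun h _ => ?_
    rw [← Finset.sum_smul, ← Finset.sum_mul, hx, zero_mul, zero_smul]
  have e5 : ∑ g, ∑ h, (x g * (p h - p g)) • ((a g - a h) ⊗ₜ[R] b h)
      = ∑ g, ∑ h, (x g * p h) • (a g ⊗ₜ[R] b h) + ∑ g, ∑ h, (x g * p g) • (a h ⊗ₜ[R] b h)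
        - ∑ g, ∑ h, (x g * p g) • (a g ⊗ₜ[R] b h)
        - ∑ g, ∑ h, (x g * p h) • (a h ⊗ₜ[R] b h) := by
    simp only [← Finset.sum_add_distrib, ← Finset.sum_sub_distrib]
    refine Finset.sum_congr rfl fun g _ => Finset.sum_congr rfl fun h _ => ?_
    rw [TensorProduct.sub_tmul]
    module
  rw [e5, e1, e2, ← e3, ← e4, sub_zero, sub_zero]

variable (G) in
/-- Differences of group elements in the augmentation ideal. -/
noncomputable def dlt (a b : G) : IGcar G :=
  ⟨Finsupp.single a 1 - Finsupp.single b 1, by simp [aug]⟩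

variable (G) in
/-- Coefficient functionals on the augmentation ideal. -/
noncomputable def cf (g : G) : IGcar G →ₗ[ℤ] ℤ :=
  (Finsupp.lapply g) ∘ₗ (LinearMap.ker (aug G)).subtype

lemma cf_sum (x : IGcar G) : ∑ g : G, cf G g x = 0 := by
  have hx : aug G x.1 = 0 := x.2
  unfold aug at hx
  rw [Finsupp.linearCombination_apply, Finsupp.sum_fintype _ _ (by simp)] at hx
  simpa [cf] using hx

lemma dlt_sub (a b c : G) : dlt G a b = dlt G a c - dlt G b c := by
  apply Subtype.ext
  simp [dlt]

lemma sum_cf_dlt (x : IGcar G) (c : G) : ∑ g : G, cf G g x • dlt G g c = x := by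
  classical
  apply Subtype.ext
  rw [AddSubmonoidClass.coe_finsetSum]
  have h1 : ∀ g : G, ((cf G g x • dlt G g c : IGcar G) : G →₀ ℤ)
      = Finsupp.single g (x.1 g) - cf G g x • Finsupp.single c 1 := by
    intro g
    simp [dlt, smul_sub, cf]
  rw [Finset.sum_congr rfl (fun g _ => h1 g), Finset.sum_sub_distrib, ← Finset.sum_smul, cf_sum,
    zero_smul, sub_zero]
  exact Finsupp.univ_sum_single x.1

lemma cf_dlt [DecidableEq G] (g a b : G) :
    cf G g (dlt G a b) = (if a = g then 1 else 0) - (if b = g then 1 else 0) := by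
  simp [cf, dlt, Finsupp.single_apply]

lemma IGρ_dlt (g a b : G) : IGρ G g (dlt G a b) = dlt G (g * a) (g * b) := by
  apply Subtype.ext
  have : ((IGρ G g (dlt G a b) : IGcar G) : G →₀ ℤ) = ofMulAction ℤ G G g (dlt G a b).1 := rfl
  rw [this]
  simp [dlt, ofMulAction, Finsupp.mapDomain_sub, Finsupp.mapDomain_single]

lemma cf_IGρ (g h : G) (x : IGcar G) : cf G h (IGρ G g x) = cf G (g⁻¹ * h) x := by
  show (Finsupp.mapDomain (fun y => g * y) x.1) h = x.1 (g⁻¹ * h)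
  conv_lhs => rw [← mul_inv_cancel_left g h]
  exact Finsupp.mapDomain_apply (mul_right_injective g) _ _

lemma preElt_eq : preElt G = ∑ h : G, (cf G h : Module.Dual ℤ (IGcar G)) ⊗ₜ[ℤ] dlt G h 1 := by
  apply (dualTensorHomEquiv ℤ (IGcar G) (IGcar G)).injective
  rw [preElt, LinearEquiv.apply_symm_apply]
  apply LinearMap.ext
  intro x
  have : dualTensorHomEquiv ℤ (IGcar G) (IGcar G)
      (∑ h : G, (cf G h : Module.Dual ℤ (IGcar G)) ⊗ₜ[ℤ] dlt G h 1)
      = ∑ h : G, dualTensorHom ℤ (IGcar G) (IGcar G)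
        ((cf G h : Module.Dual ℤ (IGcar G)) ⊗ₜ[ℤ] dlt G h 1) := by
    rw [map_sum]; rfl
  rw [this, LinearMap.sum_apply]
  simp only [dualTensorHom_apply]
  exact (sum_cf_dlt x 1).symm

lemma coevElt_eq : (coevElt G : IGcar G ⊗[ℤ] Module.Dual ℤ (IGcar G))
    = ∑ h : G, dlt G h 1 ⊗ₜ[ℤ] (cf G h : Module.Dual ℤ (IGcar G)) := by
  show (TensorProduct.comm ℤ (Module.Dual ℤ (IGcar G)) (IGcar G)) (preElt G) = _
  rw [preElt_eq, map_sum]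
  rfl

variable (G) in
/-- Evaluation `I_G ⊗ I_G^∨ ⟶ ℤ`. -/
noncomputable def evI : IGrep G ⊗ DIG G ⟶ 𝟙_ (Rep ℤ G) :=
  (ihom.ev (IGrep G)).app (𝟙_ (Rep ℤ G))

lemma evI_tmul (x : IGcar G) (φ : Module.Dual ℤ (IGcar G)) :
    (evI G).hom (x ⊗ₜ[ℤ] φ : IGcar G ⊗[ℤ] Module.Dual ℤ (IGcar G)) = φ x := by
  have := LinearMap.congr_fun (Rep.ihom_ev_app_hom (IGrep G) (𝟙_ (Rep ℤ G)))
    (x ⊗ₜ[ℤ] φ : IGcar G ⊗[ℤ] Module.Dual ℤ (IGcar G))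
  exact this

lemma evI_coevElt : (evI G).hom (coevElt G) = ((Fintype.card G : ℤ) - 1 : ℤ) := by
  classical
  have h0 : coevElt G = (∑ h : G, dlt G h 1 ⊗ₜ[ℤ] (cf G h : Module.Dual ℤ (IGcar G)) :
    IGcar G ⊗[ℤ] Module.Dual ℤ (IGcar G)) := coevElt_eq
  have h1 : (evI G).hom (coevElt G) = ∑ h : G, (cf G h (dlt G h 1) : ℤ) := by
    rw [h0]
    refine (map_sum (evI G).hom.toLinearMap _ _).trans ?_
    exact Finset.sum_congr rfl fun h _ => evI_tmul _ _
  refine h1.trans ?_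
  simp [cf_dlt, Finset.sum_sub_distrib]

lemma coev_apply (z : ℤ) : (coev G).hom (z : ℤ) = z • coevElt G := rfl

/-- The action on the dual. -/
noncomputable def dρ (g : G) : Module.Dual ℤ (IGcar G) →ₗ[ℤ] Module.Dual ℤ (IGcar G) :=
  (DIG G).ρ g

lemma dρ_apply (g : G) (φ : Module.Dual ℤ (IGcar G)) (x : IGcar G) :
    dρ g φ x = φ (IGρ G g⁻¹ x) := rfl

lemma dρ_cf (g h : G) : dρ g (cf G h) = cf G (g * h) := by
  apply LinearMap.ext
  intro x
  rw [dρ_apply, cf_IGρ, inv_inv]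

/-- The action on the tensor product. -/
noncomputable def tρ (g : G) : IGcar G ⊗[ℤ] Module.Dual ℤ (IGcar G) →ₗ[ℤ]
    IGcar G ⊗[ℤ] Module.Dual ℤ (IGcar G) :=
  (IGrep G ⊗ DIG G).ρ g

lemma tρ_tmul (g : G) (x : IGcar G) (φ : Module.Dual ℤ (IGcar G)) :
    tρ g (x ⊗ₜ φ) = (IGρ G g x) ⊗ₜ (dρ g φ) := rfl

variable (G) in
/-- The homotopy operator. -/
noncomputable def Tho : IGcar G ⊗[ℤ] Module.Dual ℤ (IGcar G) →ₗ[ℤ]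
    IGcar G ⊗[ℤ] Module.Dual ℤ (IGcar G) :=
  ∑ h : G, TensorProduct.map ((cf G 1).smulRight (dlt G 1 h))
    ((Module.Dual.eval ℤ (IGcar G) (dlt G h 1)).smulRight (cf G h))

lemma Tho_tmul (x : IGcar G) (φ : Module.Dual ℤ (IGcar G)) :
    Tho G (x ⊗ₜ φ) = ∑ h : G, (cf G 1 x * φ (dlt G h 1)) •
      (dlt G 1 h ⊗ₜ[ℤ] (cf G h : Module.Dual ℤ (IGcar G))) := by
  rw [Tho, LinearMap.sum_apply]
  refine Finset.sum_congr rfl fun h _ => ?_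
  rw [TensorProduct.map_tmul, LinearMap.smulRight_apply, LinearMap.smulRight_apply,
    TensorProduct.smul_tmul_smul]
  rfl

lemma Tho_conj (g : G) (x : IGcar G) (φ : Module.Dual ℤ (IGcar G)) :
    tρ g (Tho G (tρ g⁻¹ (x ⊗ₜ[ℤ] φ)))
    = ∑ h : G, (cf G g x * φ (dlt G h g)) •
      (dlt G g h ⊗ₜ[ℤ] (cf G h : Module.Dual ℤ (IGcar G))) := by
  rw [tρ_tmul, Tho_tmul, map_sum]
  refine Fintype.sum_equiv (Equiv.mulLeft g) _ _ fun h => ?_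
  rw [map_smul, tρ_tmul, IGρ_dlt, cf_IGρ, dρ_apply, IGρ_dlt, inv_inv, mul_one, dρ_cf]
  rfl

variable (G) in
/-- The coevaluation element, with its concrete type. -/
noncomputable def coevE : IGcar G ⊗[ℤ] Module.Dual ℤ (IGcar G) := coevElt G

lemma Tho_norm (x : IGcar G) (φ : Module.Dual ℤ (IGcar G)) :
    ∑ g : G, tρ g (Tho G (tρ g⁻¹ (x ⊗ₜ[ℤ] φ))) = x ⊗ₜ[ℤ] φ + φ x • coevE G := by
  have h0 : coevE G = ∑ h : G, dlt G h 1 ⊗ₜ[ℤ] (cf G h : Module.Dual ℤ (IGcar G)) := coevElt_eq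
  rw [h0]
  refine (Finset.sum_congr rfl fun g _ => Tho_conj g x φ).trans ?_
  have h1 := tensor_identity_aux (fun g : G => cf G g x) (fun h => φ (dlt G h 1))
    (fun g => dlt G g 1) (fun h => (cf G h : Module.Dual ℤ (IGcar G))) (cf_sum x)
    (LinearMap.ext fun y => by
      rw [LinearMap.sum_apply]; exact cf_sum y)
  have h2 : ∑ g : G, cf G g x * φ (dlt G g 1) = φ x := by
    conv_rhs => rw [← sum_cf_dlt x 1, map_sum]
    simp
  have h3 : (∑ h : G, φ (dlt G h 1) • (cf G h : Module.Dual ℤ (IGcar G))) = φ := by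
    apply LinearMap.ext
    intro y
    rw [LinearMap.sum_apply]
    conv_rhs => rw [← sum_cf_dlt y 1, map_sum]
    refine Finset.sum_congr rfl fun h _ => ?_
    simp [mul_comm]
  rw [h2, h3, sum_cf_dlt] at h1
  refine Eq.trans ?_ h1
  refine Finset.sum_congr rfl fun g _ => Finset.sum_congr rfl fun h _ => ?_
  rw [dlt_sub h g 1, dlt_sub g h 1, map_sub]

lemma coev_stIso : StIso (coev G) := by
  refine ⟨-evI G, ?_, ?_⟩
  · refine ⟨-LinearMap.id, fun z => ?_⟩
    have h1 : (coev G ≫ (-evI G) - 𝟙 (𝟙_ (Rep ℤ G))).hom z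
        = -((evI G).hom ((coev G).hom z)) - z := rfl
    rw [h1]
    change ℤ at z
    have h2 : (evI G).hom ((coev G).hom (z : ℤ)) = (z * ((Fintype.card G : ℤ) - 1) : ℤ) := by
      rw [coev_apply]
      refine (map_smul (evI G).hom.toLinearMap z _).trans ?_
      exact congrArg (fun t : ℤ => z * t) evI_coevElt
    have h3 : ∑ h : G, (𝟙_ (Rep ℤ G)).ρ h
        ((-LinearMap.id : (𝟙_ (Rep ℤ G)).V →ₗ[ℤ] (𝟙_ (Rep ℤ G)).V) ((𝟙_ (Rep ℤ G)).ρ h⁻¹ z))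
        = ∑ _h : G, (-z : ℤ) := rfl
    rw [h3]
    refine (congrArg (fun t : ℤ => -t - z) h2).trans ?_
    simp
    ring
  · have h1 : ((-evI G) ≫ coev G - 𝟙 (IGrep G ⊗ DIG G)) = -(evI G ≫ coev G + 𝟙 _) := by
      simp [sub_eq_add_neg, add_comm]
    rw [h1]
    refine IsNull.neg ⟨Tho G, fun w => ?_⟩
    have h2 : (evI G ≫ coev G + 𝟙 (IGrep G ⊗ DIG G)).hom.toLinearMap
        = (∑ g : G, tρ g ∘ₗ Tho G ∘ₗ tρ g⁻¹ :
          IGcar G ⊗[ℤ] Module.Dual ℤ (IGcar G) →ₗ[ℤ] IGcar G ⊗[ℤ] Module.Dual ℤ (IGcar G)) := by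
      refine TensorProduct.ext' fun (x : IGcar G) (φ : Module.Dual ℤ (IGcar G)) => ?_
      have h3 : (evI G ≫ coev G + 𝟙 (IGrep G ⊗ DIG G)).hom.toLinearMap (x ⊗ₜ[ℤ] φ)
          = ((evI G).hom (x ⊗ₜ[ℤ] φ : IGcar G ⊗[ℤ] Module.Dual ℤ (IGcar G)) : ℤ) • coevE G
            + (x ⊗ₜ[ℤ] φ : IGcar G ⊗[ℤ] Module.Dual ℤ (IGcar G)) := rfl
      refine h3.trans ?_
      have h4 : ((evI G).hom (x ⊗ₜ[ℤ] φ : IGcar G ⊗[ℤ] Module.Dual ℤ (IGcar G)) : ℤ) = φ x :=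
        evI_tmul x φ
      rw [h4, add_comm, ← Tho_norm x φ]
      exact (LinearMap.sum_apply (Finset.univ : Finset G)
        (fun g => tρ g ∘ₗ Tho G ∘ₗ tρ g⁻¹) (x ⊗ₜ[ℤ] φ)).symm
    refine (LinearMap.congr_fun h2 w).trans ?_
    exact LinearMap.sum_apply (Finset.univ : Finset G) (fun g => tρ g ∘ₗ Tho G ∘ₗ tρ g⁻¹) w

lemma StIso.hom {W M : Rep.{0} ℤ G} (e : W ≅ M) : StIso e.hom := StIso.of_isIso _
lemma StIso.inv {W M : Rep.{0} ℤ G} (e : W ≅ M) : StIso e.inv := StIso.of_isIso _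
lemma StIso.eqToHom {W M : Rep.{0} ℤ G} (e : W = M) : StIso (eqToHom e) := StIso.of_isIso _

lemma sMap_stIso : ∀ n : ℤ, StIso (sMap (G := G) n)
  | .ofNat m => StIso.of_isIso (𝟙 (Jp G m ⊗ IGrep G))
  | .negSucc 0 => coev_stIso.comp ((StIso.hom _).comp ((StIso.inv (λ_ (DIG G))).whiskerRight _))
  | .negSucc (m+1) => (StIso.inv (ρ_ (Jn G (m+1)))).comp
      (((coev_stIso.comp (StIso.hom (β_ (IGrep G) (DIG G)))).whiskerLeft _).comp (StIso.inv _))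

lemma tMap_stIso : ∀ n : ℤ, StIso (tMap (G := G) n)
  | .ofNat 0 => StIso.of_isIso (𝟙 (𝟙_ (Rep ℤ G) ⊗ DIG G))
  | .ofNat (m+1) => (StIso.eqToHom _).comp
      ((StIso.inv (ρ_ (Jp G m))).comp
      ((coev_stIso.whiskerLeft _).comp (StIso.inv _)))
  | .negSucc m => StIso.eqToHom (show J G (Int.negSucc m - 1) = J G (Int.negSucc m) ⊗ DIG G from rfl)

lemma μpos_stIso (i : ℤ) : ∀ m : ℕ, StIso (μpos (G := G) i m)
  | 0 => (StIso.eqToHom _).comp (StIso.inv (ρ_ (J G i)))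
  | m + 1 => (StIso.eqToHom _).comp ((sMap_stIso (i + m)).comp
      (((μpos_stIso i m).whiskerRight _).comp (StIso.hom (α_ _ _ _))))

lemma μneg_stIso (i : ℤ) : ∀ m : ℕ, StIso (μneg (G := G) i m)
  | 0 => (StIso.eqToHom _).comp (StIso.inv (ρ_ (J G i)))
  | m + 1 => (StIso.eqToHom _).comp ((tMap_stIso (i - m)).comp
      (((μneg_stIso i m).whiskerRight _).comp ((StIso.hom (α_ _ _ _)).comp
        ((StIso.eqToHom _).whiskerLeft _))))

lemma μ_stIso (i : ℤ) : ∀ j : ℤ, StIso (μ G i j)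
  | .ofNat m => μpos_stIso i m
  | .negSucc m => (StIso.eqToHom _).comp (μneg_stIso i (m+1))

end

section
variable {G : Type} [Group G] [Fintype G]

/-- Conjugation action on linear maps. -/
noncomputable def cj {W M : Rep.{0} ℤ G} (h : G) (l : W.V →ₗ[ℤ] M.V) : W.V →ₗ[ℤ] M.V :=
  M.ρ h ∘ₗ l ∘ₗ W.ρ h⁻¹

lemma cj_apply {W M : Rep.{0} ℤ G} (h : G) (l : W.V →ₗ[ℤ] M.V) (w : W.V) :
    cj h l w = M.ρ h (l (W.ρ h⁻¹ w)) := rfl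

lemma cj_one {W M : Rep.{0} ℤ G} (l : W.V →ₗ[ℤ] M.V) (w : W.V) : cj 1 l w = l w := by
  rw [cj_apply, inv_one, map_one, map_one]; rfl

lemma ρ_cj {W M : Rep.{0} ℤ G} (h a : G) (l : W.V →ₗ[ℤ] M.V) (w : W.V) :
    M.ρ h (cj a l (W.ρ h⁻¹ w)) = cj (h * a) l w := by
  rw [cj_apply, cj_apply, mul_inv_rev, map_mul, map_mul]; rfl

lemma ρ_cj' {W M : Rep.{0} ℤ G} (h a : G) (l : W.V →ₗ[ℤ] M.V) (w : W.V) :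
    M.ρ h (cj a l w) = cj (h * a) l (W.ρ h w) := by
  rw [← ρ_cj, W.ρ.inv_self_apply]

lemma cj_comp_hom {W M N : Rep.{0} ℤ G} (h : G) (l : W.V →ₗ[ℤ] M.V) (p : M ⟶ N) (w : W.V) :
    cj h (p.hom.toLinearMap ∘ₗ l : W.V →ₗ[ℤ] N.V) w = p.hom (cj h l w) :=
  (Rep.hom_comm_apply p h _).symm

lemma cj_hom {W M : Rep.{0} ℤ G} (h : G) (f : W ⟶ M) (w : W.V) :
    cj h (f.hom.toLinearMap) w = f.hom w := by
  have : cj h (f.hom.toLinearMap) w = M.ρ h (f.hom (W.ρ h⁻¹ w)) := rfl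
  rw [this, Rep.hom_comm_apply, M.ρ.self_inv_apply]

/-- Build a morphism from an invariant linear map. -/
lemma exists_hom_of_cj {W M : Rep.{0} ℤ G} (l : W.V →ₗ[ℤ] M.V) (h : ∀ g w, cj g l w = l w) :
    ∃ f : W ⟶ M, ∀ w, f.hom w = l w := by
  refine ⟨Rep.ofHom (ρ := W.ρ) (σ := M.ρ) ⟨l, fun g => LinearMap.ext fun w => ?_⟩, fun w => rfl⟩
  have := h g (W.ρ g w)
  rw [cj_apply, W.ρ.inv_self_apply] at this
  exact this.symm

/-- Scalar multiplication, with the module instance recorded unambiguously. -/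
def sm {R V : Type} [CommRing R] [AddCommGroup V] [Module R V] (r : R) (v : V) : V := r • v

section
variable {R U V N ι : Type} [CommRing R] [AddCommGroup V] [Module R V] [AddCommGroup N]
  [Module R N] [AddCommGroup U] [Module R U] [Fintype ι]

lemma map_sm (f : V →ₗ[R] N) (r : R) (v : V) : f (sm r v) = sm r (f v) := map_smul f r v

lemma sum_sm_const (c : ι → R) (hc : ∑ i, c i = 0) (v : V) : ∑ i, sm (c i) v = 0 := by
  unfold sm; rw [← Finset.sum_smul, hc, zero_smul]

lemma sum_sm_sub (c : ι → R) (hc : ∑ i, c i = 0) (v : ι → V) (v0 : V) :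
    ∑ i, sm (c i) (v i - v0) = ∑ i, sm (c i) (v i) := by
  unfold sm; simp only [smul_sub, Finset.sum_sub_distrib]
  rw [← Finset.sum_smul, hc, zero_smul, sub_zero]

lemma sum_sm_ite [DecidableEq ι] (a b : ι) (v : ι → V) :
    ∑ i, sm ((if a = i then 1 else 0) - (if b = i then 1 else 0) : R) (v i) = v a - v b := by
  simp [sm, sub_smul, Finset.sum_sub_distrib]

/-- Rank one tensors of a functional and a linear map. -/
noncomputable def bil (c : U →ₗ[R] R) (l : V →ₗ[R] N) : U ⊗[R] V →ₗ[R] N :=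
  (TensorProduct.lid R N).toLinearMap ∘ₗ TensorProduct.map c l

lemma bil_tmul (c : U →ₗ[R] R) (l : V →ₗ[R] N) (x : U) (w : V) :
    bil c l (x ⊗ₜ[R] w) = sm (c x) (l w) := by
  simp [bil, sm]

lemma exists_factor (i : N →ₗ[R] V) (hi : Function.Injective i)
    (L : U →ₗ[R] V) (hL : ∀ v, ∃ m, i m = L v) : ∃ g : U →ₗ[R] N, ∀ v, i (g v) = L v := by
  choose g hg using hL
  refine ⟨⟨⟨g, fun x y => hi ?_⟩, fun r x => hi ?_⟩, hg⟩
  · rw [hg, map_add, map_add, hg, hg]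
  · show i (g (r • x)) = i (r • g x)
    rw [hg, map_smul, map_smul, hg]
end

/-- The pure tensor in `I_G ⊗ W`. -/
noncomputable def pt {W : Rep.{0} ℤ G} (x : IGcar G) (w : W.V) : (IGrep G ⊗ W).V :=
  (x ⊗ₜ[ℤ] w : IGcar G ⊗[ℤ] W.V)

/-- Pure tensors, as a bilinear map. -/
noncomputable def ptL (W : Rep.{0} ℤ G) : IGcar G →ₗ[ℤ] W.V →ₗ[ℤ] (IGrep G ⊗ W).V :=
  TensorProduct.mk ℤ (IGcar G) W.V

lemma ptL_apply {W : Rep.{0} ℤ G} (x : IGcar G) (w : W.V) : ptL W x w = pt x w := rfl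

/-- Pure tensors with fixed right factor. -/
noncomputable def ptR (W : Rep.{0} ℤ G) (w : W.V) : IGcar G →ₗ[ℤ] (IGrep G ⊗ W).V :=
  (TensorProduct.mk ℤ (IGcar G) W.V).flip w

lemma ρ_pt {W : Rep.{0} ℤ G} (g : G) (x : IGcar G) (w : W.V) :
    (IGrep G ⊗ W).ρ g (pt x w) = pt (IGρ G g x) (W.ρ g w) := rfl

lemma pt_ext {W : Rep.{0} ℤ G} {N : Type} [AddCommGroup N] [Module ℤ N]
    (a b : (IGrep G ⊗ W).V →ₗ[ℤ] N) (h : ∀ x w, a (pt x w) = b (pt x w)) : a = b :=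
  TensorProduct.ext' h

lemma sum_form {V : Type} [AddCommGroup V] [Module ℤ V] (D : IGcar G →ₗ[ℤ] V) (v : G → V)
    (c : V) (h : ∀ a, D (dlt G a 1) = v a - c) (x : IGcar G) :
    D x = ∑ a : G, sm (cf G a x) (v a) := by
  have e : ∑ g : G, sm (cf G g x) (dlt G g 1) = x := sum_cf_dlt x 1
  conv_lhs => rw [← e, map_sum]
  simp only [map_sm, h]
  exact sum_sm_sub _ (cf_sum x) _ _

lemma ext_norm {W N : Rep.{0} ℤ G} (u : (IGrep G ⊗ W).V →ₗ[ℤ] N.V) :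
    ∃ k : W.V →ₗ[ℤ] N.V, ∀ a b w,
      cj a k w - cj b k w = ∑ c : G, cj c u (pt (dlt G a b) w) := by
  refine ⟨∑ c : G, cj c u ∘ₗ ptL W (dlt G 1 c), fun a b w => ?_⟩
  have key : ∀ h : G, cj h (∑ c : G, cj c u ∘ₗ ptL W (dlt G 1 c)) w
      = ∑ c : G, cj c u (pt (dlt G h c) w) := by
    intro h
    rw [cj_apply, LinearMap.sum_apply, map_sum]
    refine Fintype.sum_equiv (Equiv.mulLeft h) _ _ fun c => ?_
    rw [LinearMap.comp_apply, ptL_apply, ρ_cj', ρ_pt, IGρ_dlt, W.ρ.self_inv_apply, mul_one]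
    rfl
  rw [key, key, ← Finset.sum_sub_distrib]
  refine Finset.sum_congr rfl fun c _ => ?_
  rw [← map_sub, ← ptL_apply, ← ptL_apply, ← ptL_apply, ← LinearMap.sub_apply, ← map_sub,
    ← dlt_sub]

/-- The connecting relation. -/
def Conn {W M' P M : Rep.{0} ℤ G} (i : M' ⟶ P) (p : P ⟶ M) (f : W ⟶ M)
    (g : IGrep G ⊗ W ⟶ M') : Prop :=
  ∃ l : W.V →ₗ[ℤ] P.V, (∀ w, p.hom (l w) = f.hom w) ∧
    ∀ a b w, i.hom (g.hom (pt (dlt G a b) w)) = cj a l w - cj b l w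

section
variable {W M' P M : Rep.{0} ℤ G} {i : M' ⟶ P} {p : P ⟶ M}

lemma Conn.sub {f f' : W ⟶ M} {g g' : IGrep G ⊗ W ⟶ M'} (h : Conn i p f g) (h' : Conn i p f' g') :
    Conn i p (f - f') (g - g') := by
  obtain ⟨l, h1, h2⟩ := h
  obtain ⟨l', h1', h2'⟩ := h'
  refine ⟨l - l', fun w => ?_, fun a b w => ?_⟩
  · have : (f - f').hom w = f.hom w - f'.hom w := rfl
    rw [LinearMap.sub_apply, map_sub, h1, h1', this]
  · have : (g - g').hom (pt (dlt G a b) w)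
      = g.hom (pt (dlt G a b) w) - g'.hom (pt (dlt G a b) w) := rfl
    rw [this, map_sub, h2, h2']
    simp only [cj_apply, LinearMap.sub_apply, map_sub]
    abel

lemma Conn.exists_right [Module.Projective ℤ W.V] (hi : Function.Injective i.hom)
    (hp : Function.Surjective p.hom) (hex : Function.Exact i.hom p.hom) (f : W ⟶ M) :
    ∃ g, Conn i p f g := by
  obtain ⟨l, hl⟩ := Module.projective_lifting_property p.hom.toLinearMap f.hom.toLinearMap hp
  have hl' : ∀ w, p.hom (l w) = f.hom w := fun w => LinearMap.congr_fun hl w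
  have hc : ∀ a w, p.hom (cj a l w) = f.hom w := by
    intro a w
    rw [cj_apply, Rep.hom_comm_apply, hl', Rep.hom_comm_apply, M.ρ.self_inv_apply]
  let L : (IGrep G ⊗ W).V →ₗ[ℤ] P.V :=
    ∑ h : G, (bil (cf G h) (cj h l) : IGcar G ⊗[ℤ] W.V →ₗ[ℤ] P.V)
  have hLpt : ∀ x w, L (pt x w) = ∑ h : G, sm (cf G h x) (cj h l w) := by
    intro x w
    have h1 : L (pt x w) = ∑ h : G, bil (cf G h) (cj h l) (x ⊗ₜ[ℤ] w) :=
      LinearMap.sum_apply (Finset.univ : Finset G)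
        (fun h => (bil (cf G h) (cj h l) : IGcar G ⊗[ℤ] W.V →ₗ[ℤ] P.V)) (x ⊗ₜ[ℤ] w)
    rw [h1]
    exact Finset.sum_congr rfl fun h _ => bil_tmul _ _ x w
  have hpL : p.hom.toLinearMap ∘ₗ L = 0 := by
    apply pt_ext
    intro x w
    show p.hom (L (pt x w)) = 0
    rw [hLpt, map_sum]
    have : ∀ h : G, p.hom (sm (cf G h x) (cj h l w)) = sm (cf G h x) (f.hom w) := fun h => by
      rw [← hc h w]; exact map_sm p.hom.toLinearMap _ _
    simp only [this]
    exact sum_sm_const _ (cf_sum x) _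
  have hcL : ∀ g, cj g L = L := by
    intro g
    apply pt_ext
    intro x w
    rw [cj_apply, ρ_pt, hLpt, hLpt, map_sum]
    refine Fintype.sum_equiv (Equiv.mulLeft g) _ _ fun h => ?_
    rw [map_sm, ρ_cj, cf_IGρ, inv_inv]
    rfl
  obtain ⟨g, hg⟩ := exists_factor i.hom.toLinearMap hi L
    (fun v => (hex (L v)).mp (LinearMap.congr_fun hpL v))
  have hg' : ∀ v, i.hom (g v) = L v := hg
  obtain ⟨gm, hgm⟩ := exists_hom_of_cj (W := IGrep G ⊗ W) (M := M') g (fun a v => hi (by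
    rw [cj_apply, Rep.hom_comm_apply, hg', hg']
    exact LinearMap.congr_fun (hcL a) v))
  refine ⟨gm, l, hl', fun a b w => ?_⟩
  classical
  rw [hgm, hg', hLpt]
  simp only [cf_dlt]
  exact sum_sm_ite a b _

lemma Conn.exists_left (hip : ∀ x, p.hom (i.hom x) = 0) (hP : IsNull (𝟙 P))
    (g : IGrep G ⊗ W ⟶ M') : ∃ f : W ⟶ M, Conn i p f g := by
  obtain ⟨T, hT⟩ := hP
  have hT' : ∀ x, ∑ h : G, P.ρ h (T (P.ρ h⁻¹ x)) = x := fun x => (hT x).symm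
  obtain ⟨l, hl⟩ := ext_norm (W := W) (N := P)
    (T ∘ₗ i.hom.toLinearMap ∘ₗ g.hom.toLinearMap)
  have key : ∀ a b w, cj a l w - cj b l w = i.hom (g.hom (pt (dlt G a b) w)) := by
    intro a b w
    rw [hl, ← hT' (i.hom (g.hom (pt (dlt G a b) w)))]
    refine Finset.sum_congr rfl fun c _ => ?_
    rw [← Rep.hom_comm_apply, ← Rep.hom_comm_apply]
    rfl
  obtain ⟨f, hf⟩ := exists_hom_of_cj (W := W) (M := M) (p.hom.toLinearMap ∘ₗ l) (fun a w => by
    rw [cj_comp_hom]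
    have h1 := key a 1 w
    rw [cj_one, sub_eq_iff_eq_add] at h1
    rw [h1, map_add, hip, zero_add]
    rfl)
  exact ⟨f, l, fun w => (hf w).symm, fun a b w => (key a b w).symm⟩

lemma Conn.null_right [Module.Projective ℤ W.V] (hi : Function.Injective i.hom)
    (hp : Function.Surjective p.hom) (hex : Function.Exact i.hom p.hom)
    {f : W ⟶ M} {g : IGrep G ⊗ W ⟶ M'} (h : Conn i p f g) (hf : IsNull f) : IsNull g := by
  obtain ⟨l, hl, hg⟩ := h
  obtain ⟨u, hu⟩ := hf
  obtain ⟨u', hu'⟩ := Module.projective_lifting_property p.hom.toLinearMap u hp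
  have hu'' : ∀ w, p.hom (u' w) = u w := fun w => LinearMap.congr_fun hu' w
  let N : W.V →ₗ[ℤ] P.V := ∑ h : G, cj h u'
  have hN : ∀ w, N w = ∑ h : G, cj h u' w := fun w => LinearMap.sum_apply _ _ _
  have hcN : ∀ a w, cj a N w = N w := by
    intro a w
    rw [cj_apply, hN, hN, map_sum]
    refine Fintype.sum_equiv (Equiv.mulLeft a) _ _ fun c => ?_
    rw [ρ_cj]; rfl
  have hpN : ∀ w, p.hom (N w) = f.hom w := by
    intro w
    rw [hN, hu, map_sum]
    refine Finset.sum_congr rfl fun c _ => ?_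
    rw [cj_apply, Rep.hom_comm_apply, hu'']
  obtain ⟨k, hk⟩ := exists_factor i.hom.toLinearMap hi (l - N) (fun w => (hex _).mp (by
    rw [LinearMap.sub_apply, map_sub, hl, hpN, sub_self]))
  have hk' : ∀ w, i.hom (k w) = l w - N w := hk
  have hik : ∀ a w, cj a l w = i.hom (cj a k w) + N w := by
    intro a w
    rw [cj_apply a k, Rep.hom_comm_apply, hk', map_sub, ← cj_apply, ← cj_apply, hcN,
      sub_add_cancel]
  let v : (IGrep G ⊗ W).V →ₗ[ℤ] M'.V := 
    (bil (cf G 1) k : IGcar G ⊗[ℤ] W.V →ₗ[ℤ] M'.V)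
  have hv : ∀ x w, v (pt x w) = sm (cf G 1 x) (k w) := fun x w => bil_tmul _ _ x w
  have fin : g.hom.toLinearMap = ∑ h : G, cj h v := by
    apply pt_ext
    intro x w
    apply hi
    rw [LinearMap.sum_apply]
    have h1 := sum_form (i.hom.toLinearMap ∘ₗ g.hom.toLinearMap ∘ₗ ptR W w)
      (fun a => i.hom (cj a k w)) (i.hom (cj 1 k w)) (fun a => by
        show i.hom (g.hom (pt (dlt G a 1) w)) = _
        rw [hg, hik, hik]; abel) x
    refine Eq.trans h1 ?_
    rw [map_sum]
    refine Finset.sum_congr rfl fun a _ => ?_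
    rw [cj_apply a v, ρ_pt, hv, cf_IGρ, inv_inv, mul_one, map_sm]
    exact (map_sm i.hom.toLinearMap _ _).symm
  refine ⟨v, fun y => ?_⟩
  exact (LinearMap.congr_fun fin y).trans (LinearMap.sum_apply _ _ _)

lemma Conn.null_left (hip : ∀ x, p.hom (i.hom x) = 0) (hP : IsNull (𝟙 P))
    {f : W ⟶ M} {g : IGrep G ⊗ W ⟶ M'} (h : Conn i p f g) (hg0 : IsNull g) : IsNull f := by
  obtain ⟨l, hl, hg⟩ := h
  obtain ⟨v, hv⟩ := hg0
  obtain ⟨k, hk⟩ := ext_norm (W := W) (N := M') v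
  have hk' : ∀ a b w, cj a k w - cj b k w = g.hom (pt (dlt G a b) w) := by
    intro a b w
    rw [hk, hv]; rfl
  obtain ⟨f2, hf2⟩ := exists_hom_of_cj (W := W) (M := P) (l - i.hom.toLinearMap ∘ₗ k)
    (fun a w => by
      have e1 := hg a 1 w
      rw [← hk', map_sub, cj_one, cj_one] at e1
      have e2 : cj a (l - i.hom.toLinearMap ∘ₗ k : W.V →ₗ[ℤ] P.V) w
          = cj a l w - i.hom (cj a k w) := by
        rw [← cj_comp_hom]
        simp only [cj_apply, LinearMap.sub_apply, map_sub]
      have e3 : (l - i.hom.toLinearMap ∘ₗ k : W.V →ₗ[ℤ] P.V) w = l w - i.hom (k w) := rfl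
      rw [e2, e3, sub_eq_sub_iff_sub_eq_sub]
      exact e1.symm)
  have hff : f = f2 ≫ 𝟙 P ≫ p := by
    ext w
    have e1 : (f2 ≫ 𝟙 P ≫ p).hom w = p.hom (f2.hom w) := rfl
    have e3 : (l - i.hom.toLinearMap ∘ₗ k : W.V →ₗ[ℤ] P.V) w = l w - i.hom (k w) := rfl
    refine (hl w).symm.trans (Eq.trans ?_ e1.symm)
    rw [hf2, e3, map_sub, hip, sub_zero]
  rw [hff]
  exact (hP.comp_right p).comp_left f2
end

end

section
variable {G : Type} [Group G] [Fintype G]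

lemma indRep_ρ (A : Type) [AddCommGroup A] [Module ℤ A] (g : G) (x : G →₀ A) :
    (indRep G A).ρ g x = Finsupp.mapDomain (fun h => g * h) x := rfl

lemma isNull_id_indRep (A : Type) [AddCommGroup A] [Module ℤ A] : IsNull (𝟙 (indRep G A)) := by
  refine ⟨(Finsupp.lsingle 1 ∘ₗ Finsupp.lapply 1 : (G →₀ A) →ₗ[ℤ] (G →₀ A)), fun x => ?_⟩
  change G →₀ A at x
  show x = ∑ h : G, Finsupp.mapDomain (fun a => h * a)
    (Finsupp.single 1 ((Finsupp.mapDomain (fun a => h⁻¹ * a) x) 1))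
  conv_lhs => rw [← Finsupp.univ_sum_single x]
  refine Finset.sum_congr rfl fun h _ => ?_
  rw [Finsupp.mapDomain_single, mul_one]
  congr 1
  have h1 := Finsupp.mapDomain_apply (f := fun a => h⁻¹ * a) (mul_right_injective h⁻¹) x h
  simp only [inv_mul_cancel] at h1
  exact h1.symm

lemma IsInduced.isNull {P : Rep.{0} ℤ G} (h : IsInduced P) : IsNull (𝟙 P) := by
  obtain ⟨A, _, _, ⟨e⟩⟩ := h
  exact IsNull.of_iso_conj e.hom e.inv (by simp) (isNull_id_indRep A)

/-- Restriction of the action to a kernel. -/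
noncomputable def kerρ {P M : Rep.{0} ℤ G} (p : P ⟶ M) :
    Representation ℤ G (LinearMap.ker p.hom.toLinearMap) where
  toFun g := (P.ρ g).restrict (p := LinearMap.ker p.hom.toLinearMap)
    (q := LinearMap.ker p.hom.toLinearMap) (by
      intro x hx
      have hx' : p.hom x = 0 := hx
      show p.hom (P.ρ g x) = 0
      rw [Rep.hom_comm_apply, hx', map_zero])
  map_one' := by ext x; simp [LinearMap.restrict_apply]
  map_mul' g h := by ext x; simp [LinearMap.restrict_apply, Module.End.mul_apply]

lemma exists_ker {P M : Rep.{0} ℤ G} (p : P ⟶ M) : ∃ (K : Rep.{0} ℤ G) (i : K ⟶ P),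
    Function.Injective i.hom ∧ Function.Exact i.hom p.hom := by
  refine ⟨Rep.of (kerρ p), Rep.ofHom (ρ := kerρ p) (σ := P.ρ)
    ⟨(LinearMap.ker p.hom.toLinearMap).subtype, fun g => rfl⟩, Subtype.val_injective, fun x => ?_⟩
  constructor
  · intro h
    exact ⟨⟨x, h⟩, rfl⟩
  · rintro ⟨y, rfl⟩
    exact y.2

/-- The action on a cokernel. -/
noncomputable def cokρ {P M : Rep.{0} ℤ G} (i : M ⟶ P) :
    Representation ℤ G (P.V ⧸ LinearMap.range i.hom.toLinearMap) where
  toFun g := Submodule.mapQ _ _ (P.ρ g) (by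
      rintro _ ⟨x, rfl⟩
      exact ⟨M.ρ g x, Rep.hom_comm_apply i g x⟩)
  map_one' := by
    apply Submodule.linearMap_qext
    ext x
    simp
  map_mul' g h := by
    apply Submodule.linearMap_qext
    ext x
    simp

lemma exists_cok {P M : Rep.{0} ℤ G} (i : M ⟶ P) (hr : ∃ t : P.V →+ M.V, ∀ x, t (i.hom x) = x) :
    ∃ (K : Rep.{0} ℤ G) (p : P ⟶ K),
    Function.Surjective p.hom ∧ Function.Exact i.hom p.hom ∧
      ∃ s : K.V →+ P.V, ∀ x, p.hom (s x) = x := by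
  obtain ⟨t, ht⟩ := hr
  refine ⟨Rep.of (cokρ i), Rep.ofHom (ρ := P.ρ) (σ := cokρ i)
    ⟨(LinearMap.range i.hom.toLinearMap).mkQ, fun g => rfl⟩,
    Submodule.Quotient.mk_surjective _, fun x => ?_, ?_⟩
  · exact (Submodule.Quotient.mk_eq_zero (LinearMap.range i.hom.toLinearMap)).trans Iff.rfl
  · let s0 : P.V →+ P.V := AddMonoidHom.id _ - (i.hom.toLinearMap.toAddMonoidHom.comp t)
    have hs0 : ∀ x, s0 x = x - i.hom (t x) := fun x => rfl
    let s : (P.V ⧸ LinearMap.range i.hom.toLinearMap) →+ P.V :=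
      QuotientAddGroup.lift _ s0 (by
        rintro _ ⟨y, rfl⟩
        show i.hom y - i.hom (t (i.hom y)) = 0
        rw [ht, sub_self])
    refine ⟨s, fun x => ?_⟩
    obtain ⟨y, rfl⟩ := Submodule.Quotient.mk_surjective _ x
    refine (Submodule.Quotient.eq _).mpr ?_
    refine ⟨- t y, ?_⟩
    show i.hom (- t y) = (y - i.hom (t y)) - y
    rw [map_neg]; abel

/-- A `ℤ`-split short exact sequence with induced middle term. -/
structure ZS (A' P A : Rep.{0} ℤ G) (i : A' ⟶ P) (p : P ⟶ A) : Prop where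
  inj : Function.Injective i.hom
  surj : Function.Surjective p.hom
  ex : Function.Exact i.hom p.hom
  spl : ∃ s : A.V →+ P.V, ∀ x, p.hom (s x) = x
  ind : IsInduced P

lemma isInduced_indRep (A : Type) [AddCommGroup A] [Module ℤ A] : IsInduced (indRep G A) :=
  ⟨A, _, _, ⟨Iso.refl _⟩⟩

lemma exists_lsum {R M N ι : Type} [CommRing R] [AddCommGroup M] [AddCommGroup N] [Module R M]
    [Module R N] (f : ι → M →ₗ[R] N) :
    ∃ l : (ι →₀ M) →ₗ[R] N, ∀ h a, l (Finsupp.single h a) = f h a :=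
  ⟨Finsupp.lsum R f, fun h a => by simp⟩

lemma exists_down (A : Rep.{0} ℤ G) : ∃ (A' P : Rep.{0} ℤ G) (i : A' ⟶ P) (p : P ⟶ A),
    ZS A' P A i p := by
  obtain ⟨l, hl⟩ := exists_lsum (fun h => A.ρ h)
  let p : indRep G A.V ⟶ A := Rep.ofHom (ρ := (indRep G A.V).ρ) (σ := A.ρ) ⟨l, fun g => by
    apply Finsupp.lhom_ext
    intro h a
    show l ((indRep G A.V).ρ g (Finsupp.single h a)) = A.ρ g (l (Finsupp.single h a))
    rw [indRep_ρ, Finsupp.mapDomain_single, hl, hl, map_mul]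
    rfl⟩
  have hs : ∀ a, p.hom (Finsupp.single 1 a : G →₀ A.V) = a := fun a => by
    refine (hl 1 a).trans ?_
    rw [map_one]; rfl
  obtain ⟨K, i, h1, h2⟩ := exists_ker p
  exact ⟨K, _, i, p, h1, fun a => ⟨_, hs a⟩, h2, ⟨Finsupp.singleAddHom 1, hs⟩, isInduced_indRep _⟩

lemma exists_up (A : Rep.{0} ℤ G) : ∃ (P A' : Rep.{0} ℤ G) (i : A ⟶ P) (p : P ⟶ A'),
    ZS A P A' i p := by
  let l : A.V →ₗ[ℤ] (G →₀ A.V) := ∑ h : G, Finsupp.lsingle h ∘ₗ A.ρ h⁻¹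
  have hl : ∀ a, l a = ∑ h : G, Finsupp.single h (A.ρ h⁻¹ a) := fun a =>
    LinearMap.sum_apply _ _ _
  let i : A ⟶ indRep G A.V := Rep.ofHom (ρ := A.ρ) (σ := (indRep G A.V).ρ) ⟨l, fun g => by
    apply LinearMap.ext
    intro a
    show l (A.ρ g a) = (indRep G A.V).ρ g (l a)
    rw [indRep_ρ, hl, hl, Finsupp.mapDomain_finsetSum]
    symm
    refine Fintype.sum_equiv (Equiv.mulLeft g) _ _ fun h => ?_
    rw [Finsupp.mapDomain_single, Equiv.coe_mulLeft, mul_inv_rev, map_mul]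
    show _ = Finsupp.single (g * h) (A.ρ h⁻¹ (A.ρ g⁻¹ (A.ρ g a)))
    rw [A.ρ.inv_self_apply]⟩
  have ht : ∀ a, Finsupp.applyAddHom (M := A.V) (1 : G) (i.hom a) = a := fun a => by
    show (l a) 1 = a
    rw [hl, Finsupp.finsetSum_apply]
    rw [Finset.sum_eq_single 1]
    · simp
    · intro b _ hb
      simp [hb]
    · simp
  obtain ⟨K, p, h1, h2, h3⟩ := exists_cok i ⟨Finsupp.applyAddHom (M := A.V) (1 : G), ht⟩
  exact ⟨_, K, i, p, Function.LeftInverse.injective ht, h1, h2, h3, isInduced_indRep _⟩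

end

section
variable {G : Type} [Group G] [Fintype G]

section
variable {F F' : Rep.{0} ℤ G ⥤ Rep.{0} ℤ G} {X : Rep.{0} ℤ G} (η : F ⋙ tensorRight X ⟶ F')

/-- The pairing on elements. -/
noncomputable def et (A : Rep.{0} ℤ G) (m : (F.obj A).V) (x : X.V) : (F'.obj A).V :=
  (η.app A).hom (m ⊗ₜ[ℤ] x : (F.obj A).V ⊗[ℤ] X.V)

lemma et_sub (A : Rep.{0} ℤ G) (m m' : (F.obj A).V) (x : X.V) :
    et η A (m - m') x = et η A m x - et η A m' x := by
  unfold et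
  rw [TensorProduct.sub_tmul]
  exact map_sub (η.app A).hom.toLinearMap _ _

lemma et_nat {A B : Rep.{0} ℤ G} (φ : A ⟶ B) (m : (F.obj A).V) (x : X.V) :
    (F'.map φ).hom (et η A m x) = et η B ((F.map φ).hom m) x := by
  have h := η.naturality φ
  have h2 := congrArg (fun k => k.hom (m ⊗ₜ[ℤ] x : (F.obj A).V ⊗[ℤ] X.V)) h
  exact h2.symm

lemma ρ_et {A : Rep.{0} ℤ G} (g : G) (m : (F.obj A).V) (x : X.V) :
    (F'.obj A).ρ g (et η A m x) = et η A ((F.obj A).ρ g m) (X.ρ g x) :=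
  (Rep.hom_comm_apply (η.app A) g _).symm

variable {Y : Rep.{0} ℤ G} (c : Y ⟶ X)

/-- Cup product with `c` on the level of morphisms. -/
noncomputable def Ph {W A : Rep.{0} ℤ G} (f : W ⟶ F.obj A) : W ⊗ Y ⟶ F'.obj A :=
  (f ⊗ₘ c) ≫ η.app A

lemma Ph_tmul {W A : Rep.{0} ℤ G} (f : W ⟶ F.obj A) (w : W.V) (y : Y.V) :
    (Ph η c f).hom (w ⊗ₜ[ℤ] y : W.V ⊗[ℤ] Y.V) = et η A (f.hom w) (c.hom y) := rfl

lemma Ph_sub {W A : Rep.{0} ℤ G} (f f' : W ⟶ F.obj A) :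
    Ph η c (f - f') = Ph η c f - Ph η c f' := by
  have : ∀ f : W ⟶ F.obj A, Ph η c f = (f ▷ Y) ≫ (F.obj A ◁ c) ≫ η.app A := fun f => by
    unfold Ph; rw [MonoidalCategory.tensorHom_def, Category.assoc]
  have e : (f - f') ▷ Y = f ▷ Y - f' ▷ Y := by
    rw [eq_sub_iff_add_eq, ← MonoidalPreadditive.add_whiskerRight, sub_add_cancel]
  rw [this, this, this, e, Preadditive.sub_comp]

lemma Ph_comp {W W' A : Rep.{0} ℤ G} (ν : W' ⟶ W) (f : W ⟶ F.obj A) :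
    Ph η c (ν ≫ f) = (ν ▷ Y) ≫ Ph η c f := by
  unfold Ph; simp [MonoidalCategory.tensorHom_def]

lemma Ph_null {W A : Rep.{0} ℤ G} {f : W ⟶ F.obj A} (hf : IsNull f) : IsNull (Ph η c f) := by
  unfold Ph; rw [MonoidalCategory.tensorHom_def, Category.assoc]
  exact (hf.whiskerRight Y).comp_right _

lemma Ph_conn {W A' P A : Rep.{0} ℤ G} {i : A' ⟶ P} {p : P ⟶ A} {f : W ⟶ F.obj A}
    {g : IGrep G ⊗ W ⟶ F.obj A'} (h : Conn (F.map i) (F.map p) f g) :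
    Conn (F'.map i) (F'.map p) (Ph η c f) ((α_ (IGrep G) W Y).inv ≫ Ph η c g) := by
  obtain ⟨l, h1, h2⟩ := h
  let L : (W ⊗ Y).V →ₗ[ℤ] (F'.obj P).V :=
    (η.app P).hom.toLinearMap ∘ₗ (TensorProduct.map l c.hom.toLinearMap :
      W.V ⊗[ℤ] Y.V →ₗ[ℤ] (F.obj P).V ⊗[ℤ] X.V)
  have hL : ∀ (w : W.V) (y : Y.V), L (w ⊗ₜ[ℤ] y : W.V ⊗[ℤ] Y.V) = et η P (l w) (c.hom y) :=
    fun w y => rfl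
  have hcL : ∀ (a : G) (w : W.V) (y : Y.V), cj (W := W ⊗ Y) (M := F'.obj P) a L (w ⊗ₜ[ℤ] y : W.V ⊗[ℤ] Y.V)
      = et η P (cj a l w) (c.hom y) := by
    intro a w y
    have e : cj (W := W ⊗ Y) (M := F'.obj P) a L (w ⊗ₜ[ℤ] y : W.V ⊗[ℤ] Y.V)
      = (F'.obj P).ρ a (L (W.ρ a⁻¹ w ⊗ₜ[ℤ] Y.ρ a⁻¹ y : W.V ⊗[ℤ] Y.V)) := rfl
    rw [e, hL, ρ_et, ← cj_apply, ← Rep.hom_comm_apply, Y.ρ.self_inv_apply]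
  refine ⟨L, fun t => ?_, fun a b t => ?_⟩
  · have key : (F'.map p).hom.toLinearMap ∘ₗ L = (Ph η c f).hom.toLinearMap := by
      apply TensorProduct.ext'
      intro w y
      refine (et_nat η p (l w) (c.hom y)).trans ?_
      rw [h1]; rfl
    exact LinearMap.congr_fun key t
  · have key : (F'.map i).hom.toLinearMap ∘ₗ ((α_ (IGrep G) W Y).inv ≫ Ph η c g).hom.toLinearMap
        ∘ₗ ptL (W ⊗ Y) (dlt G a b) =
        cj (W := W ⊗ Y) (M := F'.obj P) a L - cj (W := W ⊗ Y) (M := F'.obj P) b L := by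
      apply TensorProduct.ext'
      intro w y
      refine (et_nat η i (g.hom (pt (dlt G a b) w)) (c.hom y)).trans ?_
      rw [h2, et_sub]
      refine Eq.trans ?_ (LinearMap.sub_apply _ _ _).symm
      rw [← hcL, ← hcL]
    exact LinearMap.congr_fun key t

/-- Stable bijectivity of the cup product on morphisms out of `W`. -/
def Qp (W A : Rep.{0} ℤ G) : Prop :=
  (∀ f : W ⟶ F.obj A, IsNull (Ph η c f) → IsNull f) ∧
  (∀ q : W ⊗ Y ⟶ F'.obj A, ∃ f : W ⟶ F.obj A, IsNull (Ph η c f - q))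

lemma Qp.of_stIso {W W' A : Rep.{0} ℤ G} {ν : W' ⟶ W} (hν : StIso ν) (h : Qp η c W A) :
    Qp η c W' A := by
  obtain ⟨ν', h1, h2⟩ := hν
  constructor
  · intro f hf
    have e1 : IsNull (ν' ≫ f) := h.1 _ (by rw [Ph_comp]; exact hf.comp_left _)
    have e2 : f = ν ≫ ν' ≫ f - (ν ≫ ν' - 𝟙 W') ≫ f := by
      simp [Preadditive.sub_comp]
    rw [e2]
    exact (e1.comp_left ν).sub (h1.comp_right f)
  · intro q
    obtain ⟨f, hf⟩ := h.2 ((ν' ▷ Y) ≫ q)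
    refine ⟨ν ≫ f, ?_⟩
    have e : Ph η c (ν ≫ f) - q = (ν ▷ Y) ≫ (Ph η c f - (ν' ▷ Y) ≫ q)
        + ((ν ≫ ν' - 𝟙 W') ▷ Y) ≫ q := by
      have e3 : (ν ≫ ν' - 𝟙 W') ▷ Y = (ν ▷ Y) ≫ (ν' ▷ Y) - 𝟙 (W' ⊗ Y) := by
        rw [eq_sub_iff_add_eq, ← comp_whiskerRight, ← id_whiskerRight,
          ← MonoidalPreadditive.add_whiskerRight, sub_add_cancel]
      rw [e3, Ph_comp]
      simp [Preadditive.sub_comp, Preadditive.comp_sub]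
    rw [e]
    exact (hf.comp_left _).add ((h1.whiskerRight Y).comp_right q)

lemma StIso.symm' {W M : Rep.{0} ℤ G} {f : W ⟶ M} (h : StIso f) : ∃ g : M ⟶ W, StIso g := by
  obtain ⟨g, h1, h2⟩ := h
  exact ⟨g, f, h2, h1⟩

lemma Qp.iff_of_stIso {W W' A : Rep.{0} ℤ G} {ν : W' ⟶ W} (hν : StIso ν) :
    Qp η c W A ↔ Qp η c W' A := by
  obtain ⟨g, hg⟩ := hν.symm'
  exact ⟨Qp.of_stIso η c hν, Qp.of_stIso η c hg⟩

section
variable {A' P A : Rep.{0} ℤ G} {i : A' ⟶ P} {p : P ⟶ A}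

lemma Shiftable.conn_data (hF : Shiftable F) (h : ZS A' P A i p) :
    (Function.Injective (F.map i).hom ∧ Function.Surjective (F.map p).hom ∧
      Function.Exact (F.map i).hom (F.map p).hom) ∧
      (∀ x, (F.map p).hom ((F.map i).hom x) = 0) ∧ IsNull (𝟙 (F.obj P)) := by
  have h1 := hF.1 _ _ _ i p h.inj h.surj h.ex h.spl
  exact ⟨h1, fun x => (h1.2.2 _).mpr ⟨x, rfl⟩, (hF.2 P h.ind).isNull⟩

lemma Qp.shift (hF : Shiftable F) (hF' : Shiftable F') (h : ZS A' P A i p) (W : Rep.{0} ℤ G)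
    [Module.Projective ℤ W.V] [Module.Projective ℤ (W ⊗ Y).V] :
    Qp η c W A ↔ Qp η c (IGrep G ⊗ W) A' := by
  obtain ⟨⟨a1, a2, a3⟩, a4, a5⟩ := hF.conn_data h
  obtain ⟨⟨b1, b2, b3⟩, b4, b5⟩ := hF'.conn_data h
  have ha : ∀ {f : (IGrep G ⊗ W) ⊗ Y ⟶ F'.obj A'},
      IsNull ((α_ (IGrep G) W Y).inv ≫ f) → IsNull f := by
    intro f hf
    have e := hf.comp_left (α_ (IGrep G) W Y).hom
    simpa using e
  constructor
  · intro hQ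
    constructor
    · intro g hg
      obtain ⟨f, hfg⟩ := Conn.exists_left a4 a5 g
      have h1 := (Ph_conn η c hfg).null_left b4 b5 (hg.comp_left _)
      exact hfg.null_right a1 a2 a3 (hQ.1 f h1)
    · intro q
      obtain ⟨t, ht⟩ := Conn.exists_left b4 b5 ((α_ (IGrep G) W Y).inv ≫ q)
      obtain ⟨f, hf⟩ := hQ.2 t
      obtain ⟨g, hg⟩ := Conn.exists_right a1 a2 a3 f
      refine ⟨g, ha ?_⟩
      have h1 := ((Ph_conn η c hg).sub ht).null_right b1 b2 b3 hf
      rwa [← Preadditive.comp_sub] at h1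
  · intro hQ
    constructor
    · intro f hf
      obtain ⟨g, hg⟩ := Conn.exists_right a1 a2 a3 f
      have h1 := (Ph_conn η c hg).null_right b1 b2 b3 hf
      exact hg.null_left a4 a5 (hQ.1 g (ha h1))
    · intro q
      obtain ⟨t, ht⟩ := Conn.exists_right b1 b2 b3 q
      obtain ⟨g, hg⟩ := hQ.2 ((α_ (IGrep G) W Y).hom ≫ t)
      obtain ⟨f, hf⟩ := Conn.exists_left a4 a5 g
      refine ⟨f, ((Ph_conn η c hf).sub ht).null_left b4 b5 ?_⟩
      have := hg.comp_left (α_ (IGrep G) W Y).inv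
      rw [Preadditive.comp_sub] at this
      simpa using this
end
end

lemma tensor_free_aux {R M N : Type} [CommRing R] [AddCommGroup M] [AddCommGroup N] [Module R M]
    [Module R N] (hM : Module.Free R M) (hN : Module.Free R N) : Module.Free R (M ⊗[R] N) :=
  inferInstance

lemma dual_free_aux {M : Type} [AddCommGroup M] [Module ℤ M]
    [Module.Finite ℤ M] [Module.Free ℤ M] : Module.Free ℤ (M →ₗ[ℤ] ℤ) :=
  inferInstance

lemma tensor_free {M N : Rep.{0} ℤ G} (hM : Module.Free ℤ M.V) (hN : Module.Free ℤ N.V) :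
    Module.Free ℤ (M ⊗ N).V := tensor_free_aux hM hN

lemma IG_free : Module.Free ℤ (IGrep G).V := inferInstanceAs (Module.Free ℤ (IGcar G))

lemma DIG_free : Module.Free ℤ (DIG G).V := dual_free_aux (M := IGcar G)

lemma unit_free : Module.Free ℤ (𝟙_ (Rep.{0} ℤ G)).V := inferInstanceAs (Module.Free ℤ ℤ)

lemma Jp_free : ∀ n : ℕ, Module.Free ℤ (Jp G n).V
  | 0 => unit_free
  | n + 1 => tensor_free (Jp_free n) IG_free

lemma Jn_free : ∀ n : ℕ, Module.Free ℤ (Jn G n).V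
  | 0 => unit_free
  | n + 1 => tensor_free (Jn_free n) DIG_free

lemma J_free : ∀ n : ℤ, Module.Free ℤ (J G n).V
  | .ofNat n => Jp_free n
  | .negSucc n => Jn_free (n + 1)

section
variable {F F' : Rep.{0} ℤ G ⥤ Rep.{0} ℤ G} {X : Rep.{0} ℤ G} (η : F ⋙ tensorRight X ⟶ F')

lemma bij_iff {r : ℤ} (c : J G r ⟶ X) (j : ℤ) (A : Rep.{0} ℤ G) :
    Function.Bijective (fun z : tate j (F.obj A) => tmap (j + r) (η.app A) (cup z (mkCls c)))
      ↔ Qp η c (J G j) A := by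
  obtain ⟨ν, h1, h2⟩ := μ_stIso (G := G) j r
  have key : ∀ f : J G j ⟶ F.obj A,
      tmap (j + r) (η.app A) (cup (mkCls f) (mkCls c)) = mkCls (μ G j r ≫ Ph η c f) := fun f => by
    rw [cup_mkCls]; exact (tmap_mkCls _ _).trans (by rw [Category.assoc]; rfl)
  have cancel : ∀ q : J G j ⊗ J G r ⟶ F'.obj A, IsNull (μ G j r ≫ q) → IsNull q := by
    intro q hq
    have e : q = ν ≫ μ G j r ≫ q - (ν ≫ μ G j r - 𝟙 _) ≫ q := by simp [Preadditive.sub_comp]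
    rw [e]
    exact (hq.comp_left ν).sub (h2.comp_right q)
  constructor
  · rintro ⟨hi, hs⟩
    constructor
    · intro f hf
      have e : mkCls f = mkCls (0 : J G j ⟶ F.obj A) := hi (by
        show tmap (j + r) (η.app A) (cup (mkCls f) (mkCls c))
          = tmap (j + r) (η.app A) (cup (mkCls 0) (mkCls c))
        rw [key, key, mkCls_eq_iff, ← Preadditive.comp_sub, ← Ph_sub, sub_zero]
        exact hf.comp_left _)
      rwa [mkCls_eq_iff, sub_zero] at e
    · intro q
      obtain ⟨z, hz⟩ := hs (mkCls (μ G j r ≫ q))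
      obtain ⟨f, rfl⟩ := mkCls_surj z
      have hz' : tmap (j + r) (η.app A) (cup (mkCls f) (mkCls c)) = mkCls (μ G j r ≫ q) := hz
      rw [key, mkCls_eq_iff, ← Preadditive.comp_sub] at hz'
      exact ⟨f, cancel _ hz'⟩
  · rintro ⟨hi, hs⟩
    constructor
    · intro z z' hz
      obtain ⟨f, rfl⟩ := mkCls_surj z
      obtain ⟨f', rfl⟩ := mkCls_surj z'
      have hz' : tmap (j + r) (η.app A) (cup (mkCls f) (mkCls c))
        = tmap (j + r) (η.app A) (cup (mkCls f') (mkCls c)) := hz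
      rw [key, key, mkCls_eq_iff, ← Preadditive.comp_sub, ← Ph_sub] at hz'
      rw [mkCls_eq_iff]
      exact hi _ (cancel _ hz')
    · intro y
      obtain ⟨q, rfl⟩ := mkCls_surj y
      obtain ⟨f, hf⟩ := hs (ν ≫ q)
      refine ⟨mkCls f, ?_⟩
      show tmap (j + r) (η.app A) (cup (mkCls f) (mkCls c)) = _
      rw [key, mkCls_eq_iff]
      have e : μ G j r ≫ Ph η c f - q = μ G j r ≫ (Ph η c f - ν ≫ q)
          + (μ G j r ≫ ν - 𝟙 _) ≫ q := by
        simp [Preadditive.sub_comp, Preadditive.comp_sub]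
      rw [e]
      exact (hf.comp_left _).add (h1.comp_right q)

lemma Qp.step (hF : Shiftable F) (hF' : Shiftable F') {r : ℤ} (c : J G r ⟶ X)
    {A' P A : Rep.{0} ℤ G} {i : A' ⟶ P} {p : P ⟶ A} (h : ZS A' P A i p) (n : ℤ) :
    Qp η c (J G n) A ↔ Qp η c (J G (n + 1)) A' := by
  have := J_free (G := G) n
  have := tensor_free (J_free (G := G) n) (J_free (G := G) r)
  rw [Qp.shift η c hF hF' h (J G n)]
  exact Qp.iff_of_stIso η c ((sMap_stIso n).comp (StIso.hom (β_ (J G n) (IGrep G))))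

lemma Qp.all (hF : Shiftable F) (hF' : Shiftable F') {r : ℤ} (c : J G r ⟶ X) (s : ℤ)
    (hs : ∀ A, Qp η c (J G s) A) (j : ℤ) : ∀ A, Qp η c (J G j) A := by
  induction j using Int.inductionOn' (b := s) with
  | zero => exact hs
  | succ k _ ih =>
    intro A
    obtain ⟨P, A', i, p, h⟩ := exists_up A
    exact (Qp.step η hF hF' c h k).mp (ih A')
  | pred k _ ih =>
    intro A
    obtain ⟨A', P, i, p, h⟩ := exists_down A
    have := (Qp.step η hF hF' c h (k - 1)).mpr
    rw [sub_add_cancel] at this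
    exact this (ih A')
end

end

end Enc

open CategoryTheory MonoidalCategory Enc

theorem statement2 (G : Type) [Group G] [Fintype G] (F F' : Rep.{0} ℤ G ⥤ Rep.{0} ℤ G)
    (hF : Shiftable F) (hF' : Shiftable F') (X : Rep.{0} ℤ G)
    (η : F ⋙ tensorRight X ⟶ F') (r s : ℤ) (c : tate r X)
    (hnat : ∀ {A B : Rep.{0} ℤ G} (φ : A ⟶ B) (z : tate s (F.obj A)),
        tmap (s + r) (η.app B) (cup (tmap s (F.map φ) z) c) =
          tmap (s + r) (F'.map φ) (tmap (s + r) (η.app A) (cup z c)))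
    (hbij : ∀ A : Rep.{0} ℤ G,
        Function.Bijective (fun z : tate s (F.obj A) => tmap (s + r) (η.app A) (cup z c))) :
    ∀ j : ℤ,
      (∀ {A B : Rep.{0} ℤ G} (φ : A ⟶ B) (z : tate j (F.obj A)),
          tmap (j + r) (η.app B) (cup (tmap j (F.map φ) z) c) =
            tmap (j + r) (F'.map φ) (tmap (j + r) (η.app A) (cup z c))) ∧
      ∀ A : Rep.{0} ℤ G,
        Function.Bijective (fun z : tate j (F.obj A) => tmap (j + r) (η.app A) (cup z c)) := by
  obtain ⟨c, rfl⟩ := mkCls_surj c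
  intro j
  refine ⟨fun {A B} φ z => ?_, fun A => ?_⟩
  · obtain ⟨f, rfl⟩ := mkCls_surj z
    have e1 : tmap (j + r) (η.app B) (cup (tmap j (F.map φ) (mkCls f)) (mkCls c))
      = mkCls ((μ G j r ≫ ((f ≫ F.map φ) ⊗ₘ c)) ≫ η.app B) := rfl
    have e2 : tmap (j + r) (F'.map φ) (tmap (j + r) (η.app A) (cup (mkCls f) (mkCls c)))
      = mkCls (((μ G j r ≫ (f ⊗ₘ c)) ≫ η.app A) ≫ F'.map φ) := rfl
    have e3 : η.app A ≫ F'.map φ = (F.map φ ▷ X) ≫ η.app B := (η.naturality φ).symm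
    rw [e1, e2]
    congr 1
    have e4 : ((f ≫ F.map φ) ⊗ₘ c) = (f ⊗ₘ c) ≫ (F.map φ ▷ X) := by
      rw [← tensorHom_id, tensorHom_comp_tensorHom, Category.comp_id]
    rw [e4, Category.assoc, Category.assoc, Category.assoc, Category.assoc]
    exact congrArg (fun t => μ G j r ≫ (f ⊗ₘ c) ≫ t) e3.symm
  · rw [bij_iff]
    exact Qp.all η hF hF' c s (fun A => (bij_iff η c s A).mp (hbij A)) j A
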